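/- arXiv:1603.02699 — 6 statements merged into one kernel-verified Lean document; each statement's English description precedes it below -/
import Mathlib

section
/- For all integers m, n ≥ 1 and all j ∈ {1,…,m}, there exists a constant C > 0 depending only on m and n such that for every s ∈ {0,…,m}, all points y_0, …, y_m ∈ ℝ^n with max_{0≤k≤m} |y_s − y_k| > 0, and every y_s' ∈ ℝ^n with |y_s − y_s'| ≤ (1/2) max_{0≤k≤m} |y_s − y_k|, one has the Calderón–Zygmund regularity estimate of order ε = 1: |K⃗_j(y_0,…,y_s,…,y_m) − K⃗_j(y_0,…,y_s',…,y_m)| ≤ C |y_s − y_s'| (Σ_{0≤k<k'≤m} |y_k − y_{k'}|)^{−(mn+1)}, where y_s' replaces y_s in position s. -/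
open MeasureTheory Metric

/-- The `m`-linear Riesz kernel on `ℝⁿ`:
`K⃗_j(y₀, y₁, …, y_m) = (y₀ − y_j)/|(y₀ − y₁, …, y₀ − y_m)|^{mn+1}`,
where the argument tuple is indexed by positions `0, 1, …, m` and `j ∈ {1, …, m}`
is encoded as `j : Fin m` acting on position `j.succ`. -/
noncomputable def rieszKernel (m n : ℕ) (j : Fin m)
    (y : Fin (m + 1) → EuclideanSpace ℝ (Fin n)) : EuclideanSpace ℝ (Fin n) :=
  ((Real.sqrt (∑ s : Fin m, ‖y 0 - y s.succ‖ ^ 2)) ^ (m * n + 1))⁻¹ • (y 0 - y j.succ)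

/-- `Σ_{0 ≤ k < k' ≤ m} |y_k − y_{k'}|`. -/
noncomputable def pairSum {m n : ℕ} (y : Fin (m + 1) → EuclideanSpace ℝ (Fin n)) : ℝ :=
  ∑ k : Fin (m + 1), ∑ k' : Fin (m + 1), if k < k' then ‖y k - y k'‖ else 0

/-- A difference estimate for `u ↦ a⁻ᴺ u` when `‖v‖ ≤ b` and `a`, `b` are
comparable. -/
theorem norm_inv_pow_smul_sub_inv_pow_smul_le {E : Type*} [NormedAddCommGroup E] [NormedSpace ℝ E]
    {a b c : ℝ} (ha : 0 < a) (hb : 0 < b) (hc : 1 ≤ c) (hac : a ≤ c * b) {u v : E}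
    (hv : ‖v‖ ≤ b) (N : ℕ) :
    ‖(a ^ (N + 1))⁻¹ • u - (b ^ (N + 1))⁻¹ • v‖ ≤
      (‖u - v‖ + (N + 1) * c ^ N * |a - b|) / a ^ (N + 1) := by
  have hsplit : (a ^ (N + 1))⁻¹ • u - (b ^ (N + 1))⁻¹ • v =
      (a ^ (N + 1))⁻¹ • (u - v) + ((a ^ (N + 1))⁻¹ - (b ^ (N + 1))⁻¹) • v := by
    module
  have hmax : max |a| |b| ≤ c * b := by
    rw [abs_of_pos ha, abs_of_pos hb]
    exact max_le hac (by nlinarith)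
  have hpow : |a ^ (N + 1) - b ^ (N + 1)| ≤ |a - b| * (N + 1) * (c * b) ^ N := by
    refine (abs_pow_sub_pow_le a b (N + 1)).trans ?_
    push_cast
    gcongr
  have hinv : |(a ^ (N + 1))⁻¹ - (b ^ (N + 1))⁻¹| =
      |a ^ (N + 1) - b ^ (N + 1)| / (a ^ (N + 1) * b ^ (N + 1)) := by
    rw [inv_sub_inv (by positivity) (by positivity), abs_div, abs_sub_comm,
      abs_of_pos (by positivity : 0 < a ^ (N + 1) * b ^ (N + 1))]
  rw [hsplit]
  calc _ ≤ ‖(a ^ (N + 1))⁻¹ • (u - v)‖ + ‖((a ^ (N + 1))⁻¹ - (b ^ (N + 1))⁻¹) • v‖ :=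
        norm_add_le _ _
    _ = (a ^ (N + 1))⁻¹ * ‖u - v‖ +
        |a ^ (N + 1) - b ^ (N + 1)| / (a ^ (N + 1) * b ^ (N + 1)) * ‖v‖ := by
        rw [norm_smul, norm_smul, Real.norm_eq_abs, Real.norm_eq_abs, hinv,
          abs_of_pos (by positivity : 0 < (a ^ (N + 1))⁻¹)]
    _ ≤ (a ^ (N + 1))⁻¹ * ‖u - v‖ +
        |a - b| * (N + 1) * (c * b) ^ N / (a ^ (N + 1) * b ^ (N + 1)) * b := by
        gcongr
    _ = _ := by
        rw [mul_pow]
        field_simp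
        ring

section
variable {m n : ℕ}

/-- The Euclidean norm of `(y₀ − y₁, …, y₀ − y_m)`. -/
noncomputable def diffNorm (y : Fin (m + 1) → EuclideanSpace ℝ (Fin n)) : ℝ :=
  Real.sqrt (∑ s : Fin m, ‖y 0 - y s.succ‖ ^ 2)

theorem diffNorm_nonneg (y : Fin (m + 1) → EuclideanSpace ℝ (Fin n)) : 0 ≤ diffNorm y :=
  Real.sqrt_nonneg _

theorem norm_zero_sub_le_diffNorm (y : Fin (m + 1) → EuclideanSpace ℝ (Fin n))
    (k : Fin (m + 1)) : ‖y 0 - y k‖ ≤ diffNorm y := by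
  induction k using Fin.cases with
  | zero => simpa using diffNorm_nonneg y
  | succ i =>
    refine Real.le_sqrt_of_sq_le ?_
    exact Finset.single_le_sum (f := fun s : Fin m => ‖y 0 - y s.succ‖ ^ 2)
      (fun _ _ => by positivity) (Finset.mem_univ i)

theorem norm_sub_le_two_mul_diffNorm (y : Fin (m + 1) → EuclideanSpace ℝ (Fin n))
    (k l : Fin (m + 1)) : ‖y k - y l‖ ≤ 2 * diffNorm y := by
  have hk := norm_zero_sub_le_diffNorm y k
  have hl := norm_zero_sub_le_diffNorm y l
  have h := norm_sub_le_norm_sub_add_norm_sub (y k) (y 0) (y l)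
  rw [norm_sub_rev (y k) (y 0)] at h
  linarith

theorem abs_diffNorm_sub_diffNorm_le {y z : Fin (m + 1) → EuclideanSpace ℝ (Fin n)} {δ : ℝ}
    (h : ∀ k, ‖y k - z k‖ ≤ δ) : |diffNorm y - diffNorm z| ≤ 2 * m * δ := by
  have hnorm (w : Fin (m + 1) → EuclideanSpace ℝ (Fin n)) :
      diffNorm w = ‖WithLp.toLp 2 (fun i : Fin m => w 0 - w i.succ)‖ := by
    rw [PiLp.norm_eq_of_L2]
    rfl
  have hδ : 0 ≤ δ := (norm_nonneg _).trans (h 0)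
  rw [hnorm, hnorm]
  refine (abs_norm_sub_norm_le _ _).trans ?_
  rw [PiLp.norm_eq_of_L2]
  refine Real.sqrt_le_iff.mpr ⟨by positivity, ?_⟩
  calc _ ≤ ∑ _i : Fin m, (2 * δ) ^ 2 := by
        refine Finset.sum_le_sum fun i _ => ?_
        refine pow_le_pow_left₀ (norm_nonneg _) ?_ 2
        change ‖(y 0 - y i.succ) - (z 0 - z i.succ)‖ ≤ _
        rw [sub_sub_sub_comm]
        linarith [norm_sub_le (y 0 - z 0) (y i.succ - z i.succ), h 0, h i.succ]
    _ = m * (2 * δ) ^ 2 := by simp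
    _ ≤ (m * m) * (2 * δ) ^ 2 := by
        gcongr
        exact_mod_cast Nat.le_mul_self m
    _ = _ := by ring

theorem pairSum_le (y : Fin (m + 1) → EuclideanSpace ℝ (Fin n)) :
    pairSum y ≤ 2 * (m + 1) ^ 2 * diffNorm y := by
  have hD := diffNorm_nonneg y
  calc pairSum y ≤ ∑ _k : Fin (m + 1), ∑ _k' : Fin (m + 1), 2 * diffNorm y := by
        refine Finset.sum_le_sum fun k _ => Finset.sum_le_sum fun k' _ => ?_
        split_ifs
        · exact norm_sub_le_two_mul_diffNorm y k k'
        · positivity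
    _ = _ := by
        simp
        ring

theorem norm_sub_le_pairSum (y : Fin (m + 1) → EuclideanSpace ℝ (Fin n)) (k l : Fin (m + 1)) :
    ‖y k - y l‖ ≤ pairSum y := by
  have hnn (a b : Fin (m + 1)) : 0 ≤ if a < b then ‖y a - y b‖ else 0 := by
    split_ifs <;> positivity
  have hlt (a b : Fin (m + 1)) (hab : a < b) : ‖y a - y b‖ ≤ pairSum y := by
    calc ‖y a - y b‖ = if a < b then ‖y a - y b‖ else 0 := (if_pos hab).symm
      _ ≤ ∑ b', if a < b' then ‖y a - y b'‖ else 0 :=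
          Finset.single_le_sum (f := fun b' => if a < b' then ‖y a - y b'‖ else 0)
            (fun b' _ => hnn a b') (Finset.mem_univ b)
      _ ≤ pairSum y :=
          Finset.single_le_sum (f := fun a' => ∑ b', if a' < b' then ‖y a' - y b'‖ else 0)
            (fun a' _ => Finset.sum_nonneg fun b' _ => hnn a' b') (Finset.mem_univ a)
  rcases lt_trichotomy k l with h | rfl | h
  · exact hlt k l h
  · rw [sub_self, norm_zero]
    exact Finset.sum_nonneg fun a _ => Finset.sum_nonneg fun b _ => hnn a b
  · rw [norm_sub_rev]
    exact hlt l k h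

end

/-- the Calderón–Zygmund regularity (smoothness) estimate of order `ε = 1`
for the multilinear Riesz kernels: for any position `s ∈ {0, …, m}`, if
`|y_s − y_s'| ≤ (1/2) max_k |y_s − y_k| ` (and the max is positive), then
`|K⃗_j(y) − K⃗_j(y with y_s replaced by y_s')| ≤ C |y_s − y_s'| (Σ_{k<k'} |y_k − y_{k'}|)^{−(mn+1)}`. -/
theorem rieszKernel_regularity_estimate (m n : ℕ) (hm : 1 ≤ m) (hn : 1 ≤ n) :
    ∃ C : ℝ, 0 < C ∧ ∀ (j : Fin m) (s : Fin (m + 1))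
      (y : Fin (m + 1) → EuclideanSpace ℝ (Fin n)) (y' : EuclideanSpace ℝ (Fin n)),
      0 < Finset.univ.sup' Finset.univ_nonempty (fun k => ‖y s - y k‖) →
      ‖y s - y'‖ ≤ (1 / 2) * Finset.univ.sup' Finset.univ_nonempty (fun k => ‖y s - y k‖) →
      ‖rieszKernel m n j y - rieszKernel m n j (Function.update y s y')‖ ≤
        C * ‖y s - y'‖ / pairSum y ^ (m * n + 1) := by
  refine ⟨(2 + (m * n + 1) * (1 + 4 * m) ^ (m * n) * (2 * m)) * (2 * (m + 1) ^ 2) ^ (m * n + 1),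
    by positivity, fun j s y y' hpos hle => ?_⟩
  obtain ⟨k, -, hk⟩ := Finset.exists_mem_eq_sup' (s := Finset.univ) Finset.univ_nonempty
    (fun k => ‖y s - y k‖)
  rw [hk] at hpos hle
  have hks : k ≠ s := by
    rintro rfl
    simp at hpos
  set z := Function.update y s y' with hz
  set δ := ‖y s - y'‖ with hδ
  have hδ0 : 0 ≤ δ := norm_nonneg _
  have hyz (l : Fin (m + 1)) : ‖y l - z l‖ ≤ δ := by
    rcases eq_or_ne l s with rfl | hl
    · simp [hz, hδ]
    · simpa [hz, hl] using hδ0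
  have hzk : ‖y s - y k‖ ≤ 4 * diffNorm z := by
    have h1 := norm_sub_le_two_mul_diffNorm z s k
    have h2 := norm_sub_le_norm_sub_add_norm_sub (y s) y' (y k)
    rw [hz, Function.update_self, Function.update_of_ne hks, ← hz] at h1
    linarith
  have ha : 0 < diffNorm y := by linarith [norm_sub_le_two_mul_diffNorm y s k]
  have hb : 0 < diffNorm z := by linarith
  have hP : 0 < pairSum y := hpos.trans_le (norm_sub_le_pairSum y s k)
  have habs : |diffNorm y - diffNorm z| ≤ 2 * m * δ := abs_diffNorm_sub_diffNorm_le hyz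
  have hac : diffNorm y ≤ (1 + 4 * m) * diffNorm z := by
    have hmδ : (m : ℝ) * δ ≤ m * (2 * diffNorm z) := by
      gcongr
      linarith
    linarith [le_abs_self (diffNorm y - diffNorm z)]
  have huv : ‖(y 0 - y j.succ) - (z 0 - z j.succ)‖ ≤ 2 * δ := by
    rw [sub_sub_sub_comm]
    linarith [norm_sub_le (y 0 - z 0) (y j.succ - z j.succ), hyz 0, hyz j.succ]
  calc ‖rieszKernel m n j y - rieszKernel m n j z‖
      ≤ (‖(y 0 - y j.succ) - (z 0 - z j.succ)‖ + ((m * n : ℕ) + 1) * (1 + 4 * m) ^ (m * n) *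
          |diffNorm y - diffNorm z|) / diffNorm y ^ (m * n + 1) :=
        norm_inv_pow_smul_sub_inv_pow_smul_le ha hb (by simp) hac
          (norm_zero_sub_le_diffNorm z j.succ) (m * n)
    _ ≤ (2 * δ + ((m * n : ℕ) + 1) * (1 + 4 * m) ^ (m * n) * (2 * m * δ)) /
          (pairSum y / (2 * (m + 1) ^ 2)) ^ (m * n + 1) := by
        gcongr
        rw [div_le_iff₀' (by positivity)]
        exact pairSum_le y
    _ = _ := by
        push_cast
        rw [div_pow]
        field_simp
end

section
/- For all integers m, n ≥ 1 and all j ∈ {1,…,m}, there exists a constant c > 0 depending only on m and n such that the m-linear Riesz transform is mn-homogeneous in the following sense: for every r > 0, every M ≥ 100, all points x_0, x_1, …, x_m ∈ ℝ^n with Mr/2 ≤ |x_0 − x_s| ≤ 2Mr for every s ∈ {1,…,m}, and every x in the ball B(x_0, r), one has |∫_{B(x_1,r)×⋯×B(x_m,r)} K⃗_j(x, y_1, …, y_m) dy_1⋯dy_m| ≥ c M^{−mn}, where the integral of the ℝ^n-valued kernel is taken componentwise and |·| is the Euclidean norm on ℝ^n. -/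
open MeasureTheory Metric

/-- A point of `closedBall a r` and a point of `closedBall b r` are at distance at most
`dist a b + 2 r`. -/
lemma norm_sub_le_of_mem_closedBall {E : Type*} [NormedAddCommGroup E] {a b p q : E} {r : ℝ}
    (hp : p ∈ closedBall a r) (hq : q ∈ closedBall b r) : ‖(p - q) - (a - b)‖ ≤ 2 * r := by
  rw [mem_closedBall_iff_norm] at hp hq
  calc ‖(p - q) - (a - b)‖ = ‖(p - a) - (q - b)‖ := by congr 1; abel
    _ ≤ ‖p - a‖ + ‖q - b‖ := norm_sub_le _ _
    _ ≤ 2 * r := by linarith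

/-- If `v` is `δ`-close to `u`, then its component along `u` is at least `‖u‖ - δ`. -/
lemma norm_mul_norm_sub_le_inner {E : Type*} [NormedAddCommGroup E] [InnerProductSpace ℝ E]
    {u v : E} {δ : ℝ} (h : ‖v - u‖ ≤ δ) : ‖u‖ * (‖u‖ - δ) ≤ inner ℝ u v := by
  have h1 : inner ℝ u v = ‖u‖ ^ 2 + inner ℝ u (v - u) := by
    rw [inner_sub_right, real_inner_self_eq_norm_sq]; ring
  have h2 := neg_le_of_abs_le (abs_real_inner_le_norm u (v - u))
  nlinarith [mul_le_mul_of_nonneg_left h (norm_nonneg u)]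

lemma sqrt_sum_sq_le_card_mul {m : ℕ} {a : Fin m → ℝ} {C : ℝ} (hC : 0 ≤ C)
    (h0 : ∀ s, 0 ≤ a s) (h : ∀ s, a s ≤ C) : Real.sqrt (∑ s, a s ^ 2) ≤ m * C := by
  refine Real.sqrt_le_iff.2 ⟨by positivity, ?_⟩
  have h1 : ∑ s, a s ^ 2 ≤ m * C ^ 2 := by
    calc ∑ s, a s ^ 2 ≤ ∑ _s : Fin m, C ^ 2 :=
          Finset.sum_le_sum fun s _ => pow_le_pow_left₀ (h0 s) (h s) 2
      _ = m * C ^ 2 := by simp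
  have h2 : (m : ℝ) ≤ (m : ℝ) ^ 2 := by exact_mod_cast Nat.le_self_pow two_ne_zero m
  nlinarith [mul_le_mul_of_nonneg_right h2 (sq_nonneg C)]

lemma sqrt_sum_norm_sq_pos {E : Type*} [NormedAddCommGroup E] {m : ℕ} {v : Fin m → E} {j : Fin m}
    (h : 0 < ‖v j‖) : 0 < Real.sqrt (∑ s, ‖v s‖ ^ 2) :=
  Real.sqrt_pos.2 <| Finset.sum_pos' (fun _ _ => sq_nonneg _) ⟨j, Finset.mem_univ j, pow_pos h 2⟩

/-- The Riesz kernel is continuous away from the set where its `j`-th difference vanishes. -/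
lemma continuousOn_rieszKernel_cons {m n : ℕ} (j : Fin m) (p : EuclideanSpace ℝ (Fin n))
    {S : Set (Fin m → EuclideanSpace ℝ (Fin n))} (hS : ∀ z ∈ S, 0 < ‖p - z j‖) :
    ContinuousOn (fun z => rieszKernel m n j (Fin.cons p z)) S := by
  simp only [rieszKernel, Fin.cons_zero, Fin.cons_succ]
  have hnum : Continuous fun z : Fin m → EuclideanSpace ℝ (Fin n) => p - z j := by fun_prop
  have hden : Continuous fun z : Fin m → EuclideanSpace ℝ (Fin n) =>
      Real.sqrt (∑ s, ‖p - z s‖ ^ 2) ^ (m * n + 1) := by fun_prop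
  refine (hden.continuousOn.inv₀ fun z hz => ?_).smul hnum.continuousOn
  exact (pow_pos (sqrt_sum_norm_sq_pos (v := fun s => p - z s) (hS z hz)) _).ne'

/-- The component of the Riesz kernel along a vector close to its `j`-th difference. -/
lemma le_inner_rieszKernel_cons {m n : ℕ} (j : Fin m) {p u : EuclideanSpace ℝ (Fin n)}
    {z : Fin m → EuclideanSpace ℝ (Fin n)} {δ C : ℝ} (hC : 0 ≤ C) (hδ : δ < ‖u‖)
    (hu : ‖(p - z j) - u‖ ≤ δ) (hz : ∀ s, ‖p - z s‖ ≤ C) :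
    ‖u‖ * (‖u‖ - δ) / (m * C) ^ (m * n + 1) ≤
      inner ℝ u (rieszKernel m n j (Fin.cons p z)) := by
  have hpos : 0 < ‖p - z j‖ := by
    have := norm_sub_norm_le u (p - z j)
    rw [norm_sub_rev u] at this
    linarith
  have hsqrt := sqrt_sum_norm_sq_pos (v := fun s => p - z s) hpos
  simp only [rieszKernel, Fin.cons_zero, Fin.cons_succ, inner_smul_right]
  have hle := sqrt_sum_sq_le_card_mul hC (fun s => norm_nonneg (p - z s)) hz
  have hnn : 0 ≤ ‖u‖ * (‖u‖ - δ) := mul_nonneg (norm_nonneg _) (by linarith)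
  rw [div_eq_inv_mul]
  exact mul_le_mul (inv_anti₀ (pow_pos hsqrt _) (pow_le_pow_left₀ hsqrt.le hle _))
    (norm_mul_norm_sub_le_inner hu) hnn (inv_nonneg.2 (pow_pos hsqrt _).le)

lemma volume_real_pi_ball {m n : ℕ} (a : Fin m → EuclideanSpace ℝ (Fin n)) {r : ℝ} (hr : 0 < r) :
    volume.real (Set.univ.pi fun s => ball (a s) r) =
      r ^ (m * n) * volume.real (ball (0 : EuclideanSpace ℝ (Fin n)) 1) ^ m := by
  rw [measureReal_def, volume_pi_pi, ENNReal.toReal_prod]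
  simp_rw [Measure.addHaar_ball_of_pos volume _ hr, ENNReal.toReal_mul,
    ENNReal.toReal_ofReal (pow_nonneg hr.le _), finrank_euclideanSpace_fin]
  rw [Finset.prod_const, Finset.card_univ, Fintype.card_fin, mul_pow, ← pow_mul, mul_comm n m,
    measureReal_def]

/-- the multilinear Riesz transform is `mn`-homogeneous: if
`Mr/2 ≤ |x₀ − x_s| ≤ 2Mr` for `s = 1, …, m` then for every `x ∈ B(x₀, r)`,
`|∫_{B(x₁,r)×⋯×B(x_m,r)} K⃗_j(x, y₁, …, y_m) dy₁⋯dy_m| ≥ c M^{−mn}`. -/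
theorem rieszTransform_mn_homogeneous (m n : ℕ) (hm : 1 ≤ m) (hn : 1 ≤ n) :
    ∃ c : ℝ, 0 < c ∧ ∀ (j : Fin m) (r M : ℝ), 0 < r → 100 ≤ M →
      ∀ x : Fin (m + 1) → EuclideanSpace ℝ (Fin n),
      (∀ s : Fin m, M * r / 2 ≤ ‖x 0 - x s.succ‖ ∧ ‖x 0 - x s.succ‖ ≤ 2 * (M * r)) →
      ∀ x' ∈ Metric.ball (x 0) r,
      c / M ^ (m * n) ≤
        ‖∫ z in Set.univ.pi (fun s : Fin m => Metric.ball (x s.succ) r),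
            rieszKernel m n j (Fin.cons x' z)‖ := by
  set ω := volume.real (ball (0 : EuclideanSpace ℝ (Fin n)) 1) with hω
  have hω0 : 0 < ω := ENNReal.toReal_pos (measure_ball_pos _ _ one_pos).ne' measure_ball_lt_top.ne
  have hm0 : (0 : ℝ) < m := by exact_mod_cast hm
  refine ⟨ω ^ m / (4 * (3 * m) ^ (m * n + 1)), by positivity, ?_⟩
  intro j r M hr hM x hx p hp
  have hMr : 100 * r ≤ M * r := mul_le_mul_of_nonneg_right hM hr.le
  set u := x 0 - x j.succ with hu
  have hu0 : 0 < ‖u‖ := by linarith [(hx j).1]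
  set A := Set.univ.pi fun s : Fin m => closedBall (x s.succ) r with hA
  set B := Set.univ.pi fun s : Fin m => ball (x s.succ) r with hB
  have hBA : B ⊆ A := Set.pi_mono fun s _ => ball_subset_closedBall
  have hclose : ∀ z ∈ A, ∀ s, ‖(p - z s) - (x 0 - x s.succ)‖ ≤ 2 * r := fun z hz s =>
    norm_sub_le_of_mem_closedBall (ball_subset_closedBall hp) (hz s (Set.mem_univ s))
  have hBm : MeasurableSet B := MeasurableSet.univ_pi fun s => measurableSet_ball
  have hBfin : volume B ≠ ⊤ := by
    rw [hB, volume_pi_pi]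
    exact ENNReal.prod_ne_top fun s _ => measure_ball_lt_top.ne
  have hint : IntegrableOn (fun z => rieszKernel m n j (Fin.cons p z)) B := by
    refine IntegrableOn.mono_set (ContinuousOn.integrableOn_compact
      (isCompact_univ_pi fun s => isCompact_closedBall _ _) ?_) hBA
    refine continuousOn_rieszKernel_cons j p fun z hz => ?_
    have h1 := norm_sub_norm_le u (p - z j)
    rw [norm_sub_rev u] at h1
    linarith [hclose z hz j, (hx j).1]
  have hlow : ∀ z ∈ B, ‖u‖ * (M * r / 4) / (m * (3 * (M * r))) ^ (m * n + 1) ≤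
      inner ℝ u (rieszKernel m n j (Fin.cons p z)) := fun z hz => by
    refine le_trans ?_ (le_inner_rieszKernel_cons (δ := 2 * r) (C := 3 * (M * r)) j
      (by linarith) (by linarith [(hx j).1]) (hclose z (hBA hz) j) fun s => ?_)
    · gcongr
      linarith [(hx j).1]
    · have h1 := norm_sub_norm_le (p - z s) (x 0 - x s.succ)
      linarith [hclose z (hBA hz) s, (hx s).2]
  have key := setIntegral_ge_of_const_le hBm hBfin hlow (hint.const_inner u)
  rw [integral_inner hint] at key
  have hcs := key.trans (real_inner_le_norm _ _)
  rw [volume_real_pi_ball _ hr, ← hω] at hcs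
  refine le_of_mul_le_mul_left (le_trans (le_of_eq ?_) hcs) hu0
  have hM0 : 0 < M := by linarith
  rw [smul_eq_mul]
  field_simp
  ring
end

section
/- For all integers m, n ≥ 1 there exists a constant c > 0 depending only on m and n such that the following pointwise sign-definite lower bound holds: let e = (1/√n)(1,…,1) ∈ ℝ^n, let x_0 ∈ ℝ^n, r > 0, M ≥ 100mn, set y_0 = x_0 and y_s = x_0 + sMr·e for s = 1,…,m; then for every i ∈ {1,…,n}, every j ∈ {1,…,m}, and all points z_s ∈ B(y_s, r) (s = 0, 1, …, m), the i-th component of the m-linear Riesz kernel satisfies K_j^{(i)}(z_0, z_1, …, z_m) ≤ −c (Mr)^{−mn}. -/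
open MeasureTheory Metric

/-- The `i`-th component of the `m`-linear Riesz kernel on `ℝⁿ`:
`K_j^{(i)}(y₀, …, y_m) = (y₀^{(i)} − y_j^{(i)})/|(y₀ − y₁, …, y₀ − y_m)|^{mn+1}`,
where the argument tuple is indexed by positions `0, 1, …, m` and `j ∈ {1, …, m}`
is encoded as `j : Fin m` acting on position `j.succ`. -/
noncomputable def rieszKernelComp (m n : ℕ) (j : Fin m) (i : Fin n)
    (y : Fin (m + 1) → EuclideanSpace ℝ (Fin n)) : ℝ :=
  (y 0 i - y j.succ i) / (Real.sqrt (∑ s : Fin m, ‖y 0 - y s.succ‖ ^ 2)) ^ (m * n + 1)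

/-- The unit vector `e = (1/√n)(1, …, 1) ∈ ℝⁿ`. -/
noncomputable def unitDiag (n : ℕ) : EuclideanSpace ℝ (Fin n) :=
  (EuclideanSpace.equiv (Fin n) ℝ).symm (fun _ => (Real.sqrt n)⁻¹)

lemma unitDiag_apply (n : ℕ) (i : Fin n) : unitDiag n i = (Real.sqrt n)⁻¹ := rfl

lemma norm_unitDiag {n : ℕ} (hn : 1 ≤ n) : ‖unitDiag n‖ = 1 := by
  have hn' : (0 : ℝ) < n := by exact_mod_cast hn
  rw [EuclideanSpace.norm_eq, Real.sqrt_eq_one]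
  simp only [unitDiag_apply, Finset.sum_const, Finset.card_univ, Fintype.card_fin, nsmul_eq_mul,
    Real.norm_eq_abs, sq_abs, inv_pow, Real.sq_sqrt hn'.le]
  exact mul_inv_cancel₀ hn'.ne'

/-- Each coordinate difference `p i - q i` of points of the balls of radius `r` around `x` and
`x + t • e` is at most `2r - t/√n`. -/
lemma coord_sub_le_of_mem_ball {n : ℕ} {x p q : EuclideanSpace ℝ (Fin n)} {r t : ℝ}
    (hp : p ∈ ball x r) (hq : q ∈ ball (x + t • unitDiag n) r) (i : Fin n) :
    p i - q i ≤ 2 * r - t * (Real.sqrt n)⁻¹ := by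
  rw [mem_ball, dist_eq_norm] at hp hq
  have h₁ := (abs_le.1 (PiLp.norm_apply_le (p - x) i)).2
  have h₂ := (abs_le.1 (PiLp.norm_apply_le (q - (x + t • unitDiag n)) i)).1
  simp only [PiLp.sub_apply, PiLp.add_apply, PiLp.smul_apply, smul_eq_mul,
    unitDiag_apply] at h₁ h₂
  linarith

lemma norm_sub_le_of_mem_ball {n : ℕ} (hn : 1 ≤ n) {x p q : EuclideanSpace ℝ (Fin n)} {r t : ℝ}
    (ht : 0 ≤ t) (hp : p ∈ ball x r) (hq : q ∈ ball (x + t • unitDiag n) r) :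
    ‖p - q‖ ≤ 2 * r + t := by
  rw [mem_ball] at hp hq
  have hxt : dist x (x + t • unitDiag n) = t := by
    rw [dist_self_add_right, norm_smul, norm_unitDiag hn, mul_one, Real.norm_of_nonneg ht]
  have h := dist_triangle4 p x (x + t • unitDiag n) q
  rw [dist_eq_norm p q, dist_comm _ q] at h
  linarith

/-- pointwise sign-definite lower bound for the components of the
multilinear Riesz kernel: with `y₀ = x₀` and `y_s = x₀ + sMr·e` (`s = 1, …, m`,
`e = (1/√n)(1,…,1)`), for all `z_s ∈ B(y_s, r)` one has
`K_j^{(i)}(z₀, z₁, …, z_m) ≤ −c (Mr)^{−mn}`. -/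
theorem rieszKernelComp_sign_definite_lower_bound (m n : ℕ) (hm : 1 ≤ m) (hn : 1 ≤ n) :
    ∃ c : ℝ, 0 < c ∧ ∀ (x₀ : EuclideanSpace ℝ (Fin n)) (r M : ℝ), 0 < r →
      (100 * m * n : ℝ) ≤ M →
      ∀ (i : Fin n) (j : Fin m) (z : Fin (m + 1) → EuclideanSpace ℝ (Fin n)),
      (∀ s : Fin (m + 1),
        z s ∈ Metric.ball (x₀ + (((s : ℕ) : ℝ) * (M * r)) • unitDiag n) r) →
      rieszKernelComp m n j i z ≤ -c / (M * r) ^ (m * n) := by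
  have hm' : (1 : ℝ) ≤ m := by exact_mod_cast hm
  have hn' : (1 : ℝ) ≤ n := by exact_mod_cast hn
  set A : ℝ := ((m : ℝ) + 1) ^ 2 with hA
  have hA0 : 0 < A := by positivity
  refine ⟨1 / (2 * n * A ^ (m * n + 1)), by positivity, fun x₀ r M hr hM i j z hz => ?_⟩
  have hnM : 100 * (n : ℝ) ≤ M := by nlinarith
  have hM0 : 0 < M := by linarith
  have hR : 0 < M * r := by positivity
  have hr2 : 2 * r ≤ M * r / (2 * n) := by
    rw [le_div_iff₀ (by positivity)]
    nlinarith
  have hr2' : 2 * r ≤ M * r := by nlinarith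
  have hz0 : z 0 ∈ ball x₀ r := by simpa using hz 0
  have hsqrt : (n : ℝ)⁻¹ ≤ (Real.sqrt n)⁻¹ := by
    have : Real.sqrt n ≤ n := Real.sqrt_le_iff.2 ⟨by linarith, by nlinarith⟩
    gcongr
  have hnum : z 0 i - z j.succ i ≤ -(M * r / (2 * n)) := by
    have h := coord_sub_le_of_mem_ball hz0 (hz j.succ) i
    have hj : (1 : ℝ) ≤ ((j.succ : ℕ) : ℝ) := by simp
    have h₁ : M * r * (n : ℝ)⁻¹ ≤ ((j.succ : ℕ) : ℝ) * (M * r) * (Real.sqrt n)⁻¹ := by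
      exact mul_le_mul (le_mul_of_one_le_left hR.le hj) hsqrt (by positivity) (by positivity)
    have h₂ : M * r * (n : ℝ)⁻¹ = 2 * (M * r / (2 * n)) := by field_simp
    linarith
  have hL : 0 < M * r / (2 * n) := by positivity
  have hD0 : 0 < Real.sqrt (∑ s : Fin m, ‖z 0 - z s.succ‖ ^ 2) := by
    refine Real.sqrt_pos.2 (Finset.sum_pos' (fun s _ => by positivity) ⟨j, Finset.mem_univ j, ?_⟩)
    have hne : z 0 - z j.succ ≠ 0 := by
      intro h
      rw [sub_eq_zero.1 h] at hnum
      linarith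
    positivity
  have hD : Real.sqrt (∑ s : Fin m, ‖z 0 - z s.succ‖ ^ 2) ≤ A * (M * r) := by
    refine Real.sqrt_le_iff.2 ⟨by positivity, ?_⟩
    have hs : ∀ s : Fin m, ‖z 0 - z s.succ‖ ^ 2 ≤ (((m : ℝ) + 1) * (M * r)) ^ 2 := by
      intro s
      have h := norm_sub_le_of_mem_ball hn (by positivity) hz0 (hz s.succ)
      have hsm : ((s.succ : ℕ) : ℝ) ≤ m := by exact_mod_cast s.isLt
      gcongr
      nlinarith
    calc _ ≤ ∑ _s : Fin m, (((m : ℝ) + 1) * (M * r)) ^ 2 := Finset.sum_le_sum fun s _ => hs s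
      _ = m * (((m : ℝ) + 1) * (M * r)) ^ 2 := by simp
      _ ≤ ((m : ℝ) + 1) ^ 2 * (((m : ℝ) + 1) * (M * r)) ^ 2 := by
        gcongr
        nlinarith
      _ = (A * (M * r)) ^ 2 := by rw [hA]; ring
  calc rieszKernelComp m n j i z
      ≤ -(M * r / (2 * n)) / (Real.sqrt (∑ s : Fin m, ‖z 0 - z s.succ‖ ^ 2)) ^ (m * n + 1) := by
        unfold rieszKernelComp
        gcongr
    _ ≤ -(M * r / (2 * n)) / (A * (M * r)) ^ (m * n + 1) := by
        rw [neg_div, neg_div]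
        gcongr
    _ = -(1 / (2 * n * A ^ (m * n + 1))) / (M * r) ^ (m * n) := by
        rw [mul_pow, pow_succ (M * r)]
        field_simp
end

section
/- Let m, n ≥ 1 be integers, i ∈ {1,…,n}, j, l ∈ {1,…,m}. Let B̄_0, B̄_1, …, B̄_m be pairwise disjoint closed balls in ℝ^n, let g be a bounded measurable function supported in B̄_0 and, for s ∈ {1,…,m}, let h_s be a bounded measurable function supported in B̄_s. Then the functions h_l·T^{*,(i)}_{j,l}(h_1,…,h_{l−1},g,h_{l+1},…,h_m) and g·T^{(i)}_j(h_1,…,h_m) both belong to L^1(ℝ^n) and ∫_{ℝ^n} Π_l(g, h_1, …, h_m)(x) dx = 0, i.e. ∫_{ℝ^n} h_l(x) T^{*,(i)}_{j,l}(h_1,…,h_{l−1},g,h_{l+1},…,h_m)(x) dx = ∫_{ℝ^n} g(x) T^{(i)}_j(h_1,…,h_m)(x) dx. -/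
open MeasureTheory Metric

/-- `T_j^{(i)}(h₁, …, h_m)(x) = ∫ K_j^{(i)}(x, z₁, …, z_m) ∏_s h_s(z_s) dz`. -/
noncomputable def Tmul (m n : ℕ) (j : Fin m) (i : Fin n)
    (h : Fin m → EuclideanSpace ℝ (Fin n) → ℝ) (x : EuclideanSpace ℝ (Fin n)) : ℝ :=
  ∫ z : Fin m → EuclideanSpace ℝ (Fin n),
    rieszKernelComp m n j i (Fin.cons x z) * ∏ s, h s (z s)

/-- The `l`-th partial adjoint
`T_{j,l}^{*,(i)}(h₁, …, h_{l−1}, g, h_{l+1}, …, h_m)(x)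
  = ∫ K_j^{(i)}(z_l, z₁, …, z_{l−1}, x, z_{l+1}, …, z_m) g(z_l) ∏_{s≠l} h_s(z_s) dz`. -/
noncomputable def TmulAdj (m n : ℕ) (j l : Fin m) (i : Fin n)
    (g : EuclideanSpace ℝ (Fin n) → ℝ) (h : Fin m → EuclideanSpace ℝ (Fin n) → ℝ)
    (x : EuclideanSpace ℝ (Fin n)) : ℝ :=
  ∫ z : Fin m → EuclideanSpace ℝ (Fin n),
    rieszKernelComp m n j i (Function.update (Fin.cons (z l) z) l.succ x) *
      (g (z l) * ∏ s ∈ Finset.univ.erase l, h s (z s))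

/-- `Π_l(g, h₁, …, h_m) = h_l · T_{j,l}^{*,(i)}(…, g, …) − g · T_j^{(i)}(h₁, …, h_m)`. -/
noncomputable def PiOp (m n : ℕ) (j l : Fin m) (i : Fin n)
    (g : EuclideanSpace ℝ (Fin n) → ℝ) (h : Fin m → EuclideanSpace ℝ (Fin n) → ℝ)
    (x : EuclideanSpace ℝ (Fin n)) : ℝ :=
  h l x * TmulAdj m n j l i g h x - g x * Tmul m n j i h x

/-- The product of the Riesz kernel with `g ⊗ h₁ ⊗ ⋯ ⊗ h_m`, a function of all `m + 1` points. -/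
noncomputable def rieszIntegrand (m n : ℕ) (j : Fin m) (i : Fin n)
    (g : EuclideanSpace ℝ (Fin n) → ℝ) (h : Fin m → EuclideanSpace ℝ (Fin n) → ℝ)
    (y : Fin (m + 1) → EuclideanSpace ℝ (Fin n)) : ℝ :=
  rieszKernelComp m n j i y * (g (y 0) * ∏ s, h s (y s.succ))

theorem continuousOn_rieszKernelComp (m n : ℕ) (j : Fin m) (i : Fin n) :
    ContinuousOn (rieszKernelComp m n j i) {y | y 0 ≠ y j.succ} := by
  unfold rieszKernelComp
  refine ContinuousOn.div (by fun_prop) (by fun_prop) fun y hy => ?_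
  have hj : 0 < ‖y 0 - y j.succ‖ ^ 2 := by
    have := norm_pos_iff.2 (sub_ne_zero.2 hy)
    positivity
  have hle : ‖y 0 - y j.succ‖ ^ 2 ≤ ∑ s : Fin m, ‖y 0 - y s.succ‖ ^ 2 :=
    Finset.single_le_sum (f := fun s : Fin m => ‖y 0 - y s.succ‖ ^ 2)
      (fun s _ => by positivity) (Finset.mem_univ j)
  exact pow_ne_zero _ (Real.sqrt_pos.2 (hj.trans_le hle)).ne'

theorem integrable_rieszIntegrand (m n : ℕ) (i : Fin n) (j : Fin m)
    (c : Fin (m + 1) → EuclideanSpace ℝ (Fin n)) (ρ : Fin (m + 1) → ℝ)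
    (hdisj : Disjoint (closedBall (c 0) (ρ 0)) (closedBall (c j.succ) (ρ j.succ)))
    (g : EuclideanSpace ℝ (Fin n) → ℝ) (hgm : Measurable g)
    (hgb : ∃ A : ℝ, ∀ x, |g x| ≤ A)
    (hgs : ∀ x, x ∉ closedBall (c 0) (ρ 0) → g x = 0)
    (h : Fin m → EuclideanSpace ℝ (Fin n) → ℝ) (hhm : ∀ s, Measurable (h s))
    (hhb : ∀ s, ∃ A : ℝ, ∀ x, |h s x| ≤ A)
    (hhs : ∀ s, ∀ x, x ∉ closedBall (c s.succ) (ρ s.succ) → h s x = 0) :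
    Integrable (rieszIntegrand m n j i g h) := by
  obtain ⟨A, hA⟩ := hgb
  choose B hB using hhb
  set S : Set (Fin (m + 1) → EuclideanSpace ℝ (Fin n)) :=
    Set.univ.pi fun k => closedBall (c k) (ρ k) with hS
  have hSc : IsCompact S := isCompact_univ_pi fun k => isCompact_closedBall _ _
  have hsupp : Function.support (rieszIntegrand m n j i g h) ⊆ S := by
    intro y hy
    have hy' : g (y 0) ≠ 0 ∧ ∀ s, h s (y s.succ) ≠ 0 := by
      simpa [rieszIntegrand, Finset.prod_ne_zero_iff] using right_ne_zero_of_mul hy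
    refine fun k _ => ?_
    refine Fin.cases ?_ (fun s => ?_) k
    · exact not_imp_comm.1 (hgs _) hy'.1
    · exact not_imp_comm.1 (hhs s _) (hy'.2 s)
  have hK : IntegrableOn (rieszKernelComp m n j i) S := by
    refine ((continuousOn_rieszKernelComp m n j i).mono fun y hy hEq => ?_).integrableOn_compact hSc
    exact Set.disjoint_left.1 hdisj (hy 0 trivial) (hEq ▸ hy j.succ trivial)
  rw [← integrableOn_iff_integrable_of_support_subset hsupp]
  refine Integrable.mul_bdd (c := A * ∏ s, B s) hK ?_ (ae_of_all _ fun y => ?_)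
  · exact ((hgm.comp (measurable_pi_apply 0)).mul
      (Finset.measurable_prod _ fun s _ =>
        (hhm s).comp (measurable_pi_apply s.succ))).aestronglyMeasurable
  · rw [norm_mul, norm_prod]
    exact mul_le_mul (hA _) (Finset.prod_le_prod (fun _ _ => norm_nonneg _) fun s _ => hB s _)
      (Finset.prod_nonneg fun _ _ => norm_nonneg _) ((abs_nonneg _).trans (hA 0))

theorem measurePreserving_finCons (m : ℕ) {E : Type*} [MeasureSpace E]
    [SigmaFinite (volume : Measure E)] :
    MeasurePreserving (fun p : E × (Fin m → E) => (Fin.cons p.1 p.2 : Fin (m + 1) → E)) := by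
  have heq : (fun p : E × (Fin m → E) => (Fin.cons p.1 p.2 : Fin (m + 1) → E)) =
      (MeasurableEquiv.piFinSuccAbove (fun _ : Fin (m + 1) => E) 0).symm := by
    funext p
    exact (Fin.insertNth_zero' p.1 p.2).symm
  rw [heq]
  exact (volume_preserving_piFinSuccAbove (fun _ : Fin (m + 1) => E) 0).symm

theorem measurePreserving_comp_swap {ι E : Type*} [Fintype ι] [DecidableEq ι] [MeasureSpace E]
    [SigmaFinite (volume : Measure E)] (a b : ι) :
    MeasurePreserving (fun y : ι → E => y ∘ Equiv.swap a b) := by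
  have heq : (fun y : ι → E => y ∘ Equiv.swap a b) =
      MeasurableEquiv.piCongrLeft (fun _ : ι => E) (Equiv.swap a b) := by
    funext y k
    obtain ⟨k, rfl⟩ := (Equiv.swap a b).surjective k
    rw [MeasurableEquiv.coe_piCongrLeft, Equiv.piCongrLeft_apply_apply, Function.comp_apply,
      Equiv.swap_apply_self]
  rw [heq]
  exact volume_measurePreserving_piCongrLeft (fun _ : ι => E) (Equiv.swap a b)

theorem mul_Tmul (m n : ℕ) (j : Fin m) (i : Fin n)
    (g : EuclideanSpace ℝ (Fin n) → ℝ) (h : Fin m → EuclideanSpace ℝ (Fin n) → ℝ)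
    (x : EuclideanSpace ℝ (Fin n)) :
    g x * Tmul m n j i h x =
      ∫ z : Fin m → EuclideanSpace ℝ (Fin n), rieszIntegrand m n j i g h (Fin.cons x z) := by
  rw [Tmul, ← integral_const_mul]
  refine integral_congr_ae (ae_of_all _ fun z => ?_)
  simp only [rieszIntegrand, Fin.cons_zero, Fin.cons_succ]
  ring

theorem mul_TmulAdj (m n : ℕ) (j l : Fin m) (i : Fin n)
    (g : EuclideanSpace ℝ (Fin n) → ℝ) (h : Fin m → EuclideanSpace ℝ (Fin n) → ℝ)
    (x : EuclideanSpace ℝ (Fin n)) :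
    h l x * TmulAdj m n j l i g h x =
      ∫ z : Fin m → EuclideanSpace ℝ (Fin n),
        rieszIntegrand m n j i g h
          ((Fin.cons x z : Fin (m + 1) → EuclideanSpace ℝ (Fin n)) ∘ Equiv.swap 0 l.succ) := by
  rw [TmulAdj, ← integral_const_mul]
  refine integral_congr_ae (ae_of_all _ fun z => ?_)
  have hswap : (Fin.cons x z : Fin (m + 1) → EuclideanSpace ℝ (Fin n)) ∘ Equiv.swap 0 l.succ =
      Function.update (Fin.cons (z l) z) l.succ x := by
    ext1 k
    refine Fin.cases ?_ (fun s => ?_) k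
    · simp [Function.update_of_ne (Fin.succ_ne_zero l).symm]
    · by_cases hs : s = l
      · subst hs; simp
      · simp [hs, Equiv.swap_apply_of_ne_of_ne (Fin.succ_ne_zero s)
          (fun e => hs (Fin.succ_injective _ e))]
  have hprod : ∏ s, h s (Function.update (Fin.cons (z l) z :
      Fin (m + 1) → EuclideanSpace ℝ (Fin n)) l.succ x s.succ) =
      h l x * ∏ s ∈ Finset.univ.erase l, h s (z s) := by
    rw [← Finset.mul_prod_erase _ _ (Finset.mem_univ l), Function.update_self]
    congr 1
    refine Finset.prod_congr rfl fun s hs => ?_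
    rw [Function.update_of_ne (fun e => Finset.ne_of_mem_erase hs (Fin.succ_injective _ e)),
      Fin.cons_succ]
  simp only [rieszIntegrand]
  rw [hswap, hprod, Function.update_of_ne (Fin.succ_ne_zero l).symm, Fin.cons_zero]
  ring

/-- for bounded measurable `g, h₁, …, h_m` supported in pairwise disjoint
closed balls `B̄₀, B̄₁, …, B̄_m`, the two constituents of `Π_l(g, h₁, …, h_m)` are
integrable and `∫ Π_l(g, h₁, …, h_m) = 0`, i.e.
`∫ h_l(x) T_{j,l}^{*,(i)}(…, g, …)(x) dx = ∫ g(x) T_j^{(i)}(h₁, …, h_m)(x) dx`. -/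
theorem piOp_integral_zero (m n : ℕ) (hm : 1 ≤ m) (hn : 1 ≤ n)
    (i : Fin n) (j l : Fin m)
    (c : Fin (m + 1) → EuclideanSpace ℝ (Fin n)) (ρ : Fin (m + 1) → ℝ)
    (hdisj : ∀ k k', k ≠ k' →
      Disjoint (Metric.closedBall (c k) (ρ k)) (Metric.closedBall (c k') (ρ k')))
    (g : EuclideanSpace ℝ (Fin n) → ℝ) (hgm : Measurable g)
    (hgb : ∃ A : ℝ, ∀ x, |g x| ≤ A)
    (hgs : ∀ x, x ∉ Metric.closedBall (c 0) (ρ 0) → g x = 0)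
    (h : Fin m → EuclideanSpace ℝ (Fin n) → ℝ) (hhm : ∀ s, Measurable (h s))
    (hhb : ∀ s, ∃ A : ℝ, ∀ x, |h s x| ≤ A)
    (hhs : ∀ s, ∀ x, x ∉ Metric.closedBall (c s.succ) (ρ s.succ) → h s x = 0) :
    Integrable (fun x => h l x * TmulAdj m n j l i g h x) volume ∧
    Integrable (fun x => g x * Tmul m n j i h x) volume ∧
    (∫ x, PiOp m n j l i g h x) = 0 ∧
    (∫ x, h l x * TmulAdj m n j l i g h x) = ∫ x, g x * Tmul m n j i h x := by
  have hG := integrable_rieszIntegrand m n i j c ρ (hdisj 0 j.succ (Fin.succ_ne_zero j).symm)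
    g hgm hgb hgs h hhm hhb hhs
  have hcons := measurePreserving_finCons m (E := EuclideanSpace ℝ (Fin n))
  have hswap := measurePreserving_comp_swap (E := EuclideanSpace ℝ (Fin n)) 0 l.succ
  have hGs := hswap.integrable_comp_of_integrable hG
  have hG₂ := hcons.integrable_comp_of_integrable hG
  have hGs₂ := hcons.integrable_comp_of_integrable hGs
  have hint₁ : Integrable (fun x => h l x * TmulAdj m n j l i g h x) volume := by
    simp only [mul_TmulAdj]
    exact hGs₂.integral_prod_left
  have hint₂ : Integrable (fun x => g x * Tmul m n j i h x) volume := by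
    simp only [mul_Tmul]
    exact hG₂.integral_prod_left
  have hcomp {α β : Type} [MeasurableSpace α] [MeasurableSpace β] {μ : Measure α} {ν : Measure β}
      {f : α → β} (hf : MeasurePreserving f μ ν) {F : β → ℝ} (hF : Integrable F ν) :
      ∫ x, F (f x) ∂μ = ∫ y, F y ∂ν := by
    rw [← hf.map_eq] at hF ⊢
    exact (integral_map hf.aemeasurable hF.aestronglyMeasurable).symm
  have heq : (∫ x, h l x * TmulAdj m n j l i g h x) = ∫ x, g x * Tmul m n j i h x := by
    simp only [mul_TmulAdj, mul_Tmul]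
    calc _ = ∫ p, _ := (integral_prod _ hGs₂).symm
      _ = ∫ y, _ := hcomp hcons hGs
      _ = ∫ y, _ := hcomp hswap hG
      _ = ∫ p, _ := (hcomp hcons hG).symm
      _ = _ := integral_prod _ hG₂
  refine ⟨hint₁, hint₂, ?_, heq⟩
  simp only [PiOp]
  rw [integral_sub hint₁ hint₂, heq, sub_self]
end

section
/- For every integer n ≥ 1 there exists a constant C > 0 depending only on n such that: for all x_0, y_0 ∈ ℝ^n, r > 0 and M > 10 with |x_0 − y_0| = Mr, for every f ∈ L^1(ℝ^n) with ∫_{ℝ^n} f = 0 and |f(x)| ≤ r^{−n}(χ_{B(x_0,r)}(x) + χ_{B(y_0,r)}(x)) for a.e. x, and for every locally integrable b : ℝ^n → ℝ with mean oscillation at most N, the product f·b is integrable and |∫_{ℝ^n} f(x) b(x) dx| ≤ C N log M. -/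
open MeasureTheory Metric

/-- The average of `b` over a subset `s` of `t` differs from a constant `c` by at most
`|t| / |s|` times the mean of `|b - c|` over `t`. -/
theorem abs_setAverage_sub_le {α : Type*} [MeasurableSpace α] {μ : Measure α} {s t : Set α}
    {b : α → ℝ} {c D : ℝ} (hst : s ⊆ t) (hs : 0 < μ.real s) (ht : μ t ≠ ⊤)
    (hb : IntegrableOn b t μ) (hD : μ.real t ≤ D * μ.real s) :
    |(⨍ x in s, b x ∂μ) - c| ≤ D * ⨍ x in t, |b x - c| ∂μ := by
  have hs' : μ s ≠ ⊤ := measure_ne_top_of_subset hst ht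
  have hbc : IntegrableOn (fun x => b x - c) t μ := hb.sub (integrableOn_const ht)
  have ht0 : 0 < μ.real t := hs.trans_le (measureReal_mono hst ht)
  have h1 : (⨍ x in s, b x ∂μ) - c = (μ.real s)⁻¹ * ∫ x in s, (b x - c) ∂μ := by
    rw [integral_sub (hb.mono_set hst) (integrableOn_const hs'), setAverage_eq, setIntegral_const]
    simp only [smul_eq_mul]
    field_simp
  have h2 : |∫ x in s, (b x - c) ∂μ| ≤ ∫ x in t, |b x - c| ∂μ :=
    abs_integral_le_integral_abs.trans
      (setIntegral_mono_set hbc.abs (.of_forall fun _ => abs_nonneg _) hst.eventuallyLE)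
  have h3 : 0 ≤ ∫ x in t, |b x - c| ∂μ := integral_nonneg fun _ => abs_nonneg _
  rw [h1, abs_mul, abs_of_pos (inv_pos.2 hs), setAverage_eq, smul_eq_mul, ← mul_assoc]
  refine mul_le_mul ?_ h2 (abs_nonneg _) ?_
  · rw [← div_eq_mul_inv, inv_eq_one_div, div_le_div_iff₀ hs ht0]
    linarith
  · have : 0 ≤ D := by
      by_contra! h
      nlinarith
    positivity

section Oscillation

variable {n : ℕ} {b : EuclideanSpace ℝ (Fin n) → ℝ} {N : ℝ}

theorem integrableOn_ball_of_locallyIntegrable (hb : LocallyIntegrable b volume)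
    (x : EuclideanSpace ℝ (Fin n)) (t : ℝ) : IntegrableOn b (ball x t) :=
  (hb.integrableOn_isCompact (isCompact_closedBall x t)).mono_set ball_subset_closedBall

theorem volume_real_ball_eq_pow_mul (x : EuclideanSpace ℝ (Fin n)) {t : ℝ} (ht : 0 < t) :
    volume.real (ball x t) = t ^ n * volume.real (ball (0 : EuclideanSpace ℝ (Fin n)) 1) := by
  rw [measureReal_def, Measure.addHaar_ball_of_pos _ x ht, ENNReal.toReal_mul,
    ENNReal.toReal_ofReal (by positivity), finrank_euclideanSpace_fin, measureReal_def]

theorem volume_real_ball_pos (x : EuclideanSpace ℝ (Fin n)) {t : ℝ} (ht : 0 < t) :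
    0 < volume.real (ball x t) :=
  ENNReal.toReal_pos (measure_ball_pos _ _ ht).ne' measure_ball_lt_top.ne

/-- Averages over a ball and over a ball of at most twice the radius containing it are close. -/
theorem abs_setAverage_ball_sub_le_of_subset (hb : LocallyIntegrable b volume)
    (hN : ∀ (x : EuclideanSpace ℝ (Fin n)) (t : ℝ), 0 < t →
      ⨍ y in ball x t, |b y - ⨍ z in ball x t, b z| ≤ N)
    {x y : EuclideanSpace ℝ (Fin n)} {s : ℝ} (hs : 0 < s) (hsub : ball x s ⊆ ball y (2 * s)) :
    |(⨍ z in ball x s, b z) - ⨍ z in ball y (2 * s), b z| ≤ 2 ^ n * N := by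
  refine (abs_setAverage_sub_le hsub (volume_real_ball_pos x hs) measure_ball_lt_top.ne
    (integrableOn_ball_of_locallyIntegrable hb _ _) (D := 2 ^ n) (le_of_eq ?_)).trans
    (mul_le_mul_of_nonneg_left (hN y (2 * s) (by positivity)) (by positivity))
  rw [volume_real_ball_eq_pow_mul _ hs, volume_real_ball_eq_pow_mul _ (by positivity : 0 < 2 * s)]
  ring

theorem abs_setAverage_ball_sub_two_pow_le (hb : LocallyIntegrable b volume)
    (hN : ∀ (x : EuclideanSpace ℝ (Fin n)) (t : ℝ), 0 < t →
      ⨍ y in ball x t, |b y - ⨍ z in ball x t, b z| ≤ N)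
    (x : EuclideanSpace ℝ (Fin n)) {r : ℝ} (hr : 0 < r) (k : ℕ) :
    |(⨍ z in ball x r, b z) - ⨍ z in ball x (2 ^ k * r), b z| ≤ k * (2 ^ n * N) := by
  induction k with
  | zero => simp
  | succ k ih =>
    have h := abs_setAverage_ball_sub_le_of_subset hb hN (x := x) (y := x) (s := 2 ^ k * r)
      (by positivity) (ball_subset_ball (le_mul_of_one_le_left (by positivity) one_le_two))
    rw [← mul_assoc, ← pow_succ'] at h
    push_cast
    linarith [abs_sub_le (⨍ z in ball x r, b z) (⨍ z in ball x (2 ^ k * r), b z)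
      (⨍ z in ball x (2 ^ (k + 1) * r), b z)]

theorem setIntegral_ball_abs_sub_le (hb : LocallyIntegrable b volume)
    (hN : ∀ (x : EuclideanSpace ℝ (Fin n)) (t : ℝ), 0 < t →
      ⨍ y in ball x t, |b y - ⨍ z in ball x t, b z| ≤ N)
    (x : EuclideanSpace ℝ (Fin n)) {r : ℝ} (hr : 0 < r) (c : ℝ) :
    ∫ z in ball x r, |b z - c| ≤ volume.real (ball x r) * (N + |(⨍ z in ball x r, b z) - c|) := by
  set a := ⨍ z in ball x r, b z
  have hv := volume_real_ball_pos x hr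
  have hfin : volume (ball x r) ≠ ⊤ := measure_ball_lt_top.ne
  have hI := integrableOn_ball_of_locallyIntegrable hb x r
  have hc (d : ℝ) : IntegrableOn (fun _ => d) (ball x r) volume := integrableOn_const hfin
  have ha : IntegrableOn (fun z => |b z - a|) (ball x r) volume := (hI.sub (hc a)).abs
  have h := hN x r hr
  rw [setAverage_eq, smul_eq_mul, inv_mul_le_iff₀ hv] at h
  calc ∫ z in ball x r, |b z - c|
      ≤ ∫ z in ball x r, (|b z - a| + |a - c|) :=
        integral_mono (hI.sub (hc c)).abs (ha.add (hc _)) fun z => abs_sub_le _ _ _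
    _ = (∫ z in ball x r, |b z - a|) + volume.real (ball x r) * |a - c| := by
        rw [integral_add ha (hc _), setIntegral_const, smul_eq_mul]
    _ ≤ _ := by rw [mul_add]; gcongr

end Oscillation

/-- dual (pairing) form of the `‖f‖_{H¹} ≲ log M` lemma: if `f` has mean
zero and `|f| ≤ r^{−n}(χ_{B(x₀,r)} + χ_{B(y₀,r)})` with `|x₀ − y₀| = Mr`, `M > 10`, then
for every locally integrable `b` with mean oscillation at most `N`,
`|∫ f b| ≤ C N log M`. -/
theorem pairing_two_bump_log_estimate (n : ℕ) (hn : 1 ≤ n) :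
    ∃ C : ℝ, 0 < C ∧ ∀ (x₀ y₀ : EuclideanSpace ℝ (Fin n)) (r M : ℝ),
      0 < r → 10 < M → dist x₀ y₀ = M * r →
      ∀ f : EuclideanSpace ℝ (Fin n) → ℝ, Integrable f volume →
      (∫ x, f x) = 0 →
      (∀ᵐ x, |f x| ≤ (r ^ n)⁻¹ *
        ((Metric.ball x₀ r).indicator (fun _ => (1 : ℝ)) x +
          (Metric.ball y₀ r).indicator (fun _ => (1 : ℝ)) x)) →
      ∀ (b : EuclideanSpace ℝ (Fin n) → ℝ) (N : ℝ), LocallyIntegrable b volume →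
      (∀ (x : EuclideanSpace ℝ (Fin n)) (t : ℝ), 0 < t →
        ⨍ y in Metric.ball x t, |b y - ⨍ z in Metric.ball x t, b z| ≤ N) →
      Integrable (fun x => f x * b x) volume ∧
      |∫ x, f x * b x| ≤ C * N * Real.log M := by
  set ω := volume.real (ball (0 : EuclideanSpace ℝ (Fin n)) 1) with hω
  have hω0 : 0 < ω := volume_real_ball_pos _ one_pos
  refine ⟨8 * 2 ^ n * ω, by positivity, ?_⟩
  intro x₀ y₀ r M hr hM hdist f hf hf0 hfb b N hb hN
  have hN0 : 0 ≤ N := by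
    refine le_trans ?_ (hN x₀ r hr)
    rw [setAverage_eq]
    exact smul_nonneg (by positivity) (integral_nonneg fun _ => abs_nonneg _)
  obtain ⟨k, hk1, hk2⟩ := exists_nat_pow_near (by linarith : 1 ≤ M) one_lt_two
  set c := ⨍ z in ball x₀ (2 ^ (k + 2) * r), b z
  have hx : |(⨍ z in ball x₀ r, b z) - c| ≤ (k + 2) * (2 ^ n * N) := by
    simpa using abs_setAverage_ball_sub_two_pow_le hb hN x₀ hr (k + 2)
  have hy : |(⨍ z in ball y₀ r, b z) - c| ≤ (k + 2) * (2 ^ n * N) := by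
    have h1 := abs_setAverage_ball_sub_two_pow_le hb hN y₀ hr (k + 1)
    have h2 := abs_setAverage_ball_sub_le_of_subset hb hN (x := y₀) (y := x₀)
      (s := 2 ^ (k + 1) * r) (by positivity) (ball_subset_ball' (by
        rw [dist_comm, hdist]
        nlinarith))
    rw [← mul_assoc, ← pow_succ'] at h2
    push_cast at h1
    linarith [abs_sub_le (⨍ z in ball y₀ r, b z) (⨍ z in ball y₀ (2 ^ (k + 1) * r), b z) c]
  have hlog : (k : ℝ) + 3 ≤ 4 * Real.log M := by
    have h1 : k * Real.log 2 ≤ Real.log M := by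
      rw [← Real.log_pow]
      exact Real.log_le_log (by positivity) hk1
    have h2 : 3 * Real.log 2 ≤ Real.log M := by
      rw [show (3 : ℝ) = (3 : ℕ) by norm_num, ← Real.log_pow]
      exact Real.log_le_log (by positivity) (by linarith)
    have := Real.log_two_gt_d9
    nlinarith [(Nat.cast_nonneg k : (0 : ℝ) ≤ k)]
  have hbound {x : EuclideanSpace ℝ (Fin n)}
      (h : |(⨍ z in ball x r, b z) - c| ≤ (k + 2) * (2 ^ n * N)) :
      (r ^ n)⁻¹ * ∫ z in ball x r, |b z - c| ≤ 4 * 2 ^ n * ω * N * Real.log M := by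
    have h1 := setIntegral_ball_abs_sub_le hb hN x hr c
    rw [volume_real_ball_eq_pow_mul x hr, ← hω, mul_assoc] at h1
    rw [inv_mul_le_iff₀ (by positivity)]
    refine h1.trans (mul_le_mul_of_nonneg_left ?_ (by positivity))
    have h2 : N ≤ 2 ^ n * N := le_mul_of_one_le_left hN0 (one_le_pow₀ one_le_two)
    calc ω * (N + |(⨍ z in ball x r, b z) - c|)
        ≤ ω * (2 ^ n * N + (k + 2) * (2 ^ n * N)) := by gcongr
      _ = ω * (2 ^ n * N) * (k + 3) := by ring
      _ ≤ ω * (2 ^ n * N) * (4 * Real.log M) := by gcongr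
      _ = _ := by ring
  have hind (x : EuclideanSpace ℝ (Fin n)) :
      Integrable ((ball x r).indicator fun z => |b z - c|) volume :=
    IntegrableOn.integrable_indicator ((integrableOn_ball_of_locallyIntegrable hb x r).sub
      (integrableOn_const measure_ball_lt_top.ne)).abs measurableSet_ball
  have hdom : Integrable (fun z => (r ^ n)⁻¹ * ((ball x₀ r).indicator (fun z => |b z - c|) z +
      (ball y₀ r).indicator (fun z => |b z - c|) z)) volume :=
    ((hind x₀).add (hind y₀)).const_mul _
  have hle : ∀ᵐ z, ‖f z * (b z - c)‖ ≤ (r ^ n)⁻¹ *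
      ((ball x₀ r).indicator (fun z => |b z - c|) z +
        (ball y₀ r).indicator (fun z => |b z - c|) z) := by
    filter_upwards [hfb] with z hz
    rw [Real.norm_eq_abs, abs_mul]
    refine (mul_le_mul_of_nonneg_right hz (abs_nonneg _)).trans_eq ?_
    by_cases h1 : z ∈ ball x₀ r <;> by_cases h2 : z ∈ ball y₀ r <;>
      simp [h1, h2, mul_add, add_mul]
  have hfbc : Integrable (fun z => f z * (b z - c)) volume :=
    hdom.mono' (hf.aestronglyMeasurable.mul
      (hb.aestronglyMeasurable.sub aestronglyMeasurable_const)) hle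
  have hsplit : (fun z => f z * b z) = fun z => f z * (b z - c) + f z * c := by
    ext z
    ring
  refine ⟨hsplit ▸ hfbc.add (hf.mul_const c), ?_⟩
  rw [hsplit, integral_add hfbc (hf.mul_const c), integral_mul_const, hf0, zero_mul, add_zero]
  refine (norm_integral_le_of_norm_le hdom hle).trans ?_
  rw [integral_const_mul, integral_add (hind x₀) (hind y₀), integral_indicator measurableSet_ball,
    integral_indicator measurableSet_ball, mul_add]
  linarith [hbound hx, hbound hy]
end

section
/- For all integers m, n ≥ 1 there exists a constant C > 0 depending only on m and n such that the following holds. Let i ∈ {1,…,n}, j, l ∈ {1,…,m}, let e = (1/√n)(1,…,1) ∈ ℝ^n, let x_0 ∈ ℝ^n, r > 0, M ≥ 100mn, set y_s = x_0 + sMr·e for s = 1,…,m, and let a be an H^1-atom associated with B(x_0, r). Define g = χ_{B(y_l,r)}, h_s = χ_{B(y_s,r)} for s ∈ {1,…,m}, s ≠ l, let c_0 = ∫_{B(y_1,r)×⋯×B(y_m,r)} K_j^{(i)}(z_l, z_1, …, z_{l−1}, x_0, z_{l+1}, …, z_m) dz_1⋯dz_m (which is nonzero), and set h_l = a/c_0.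 Then for a.e. x ∈ ℝ^n, |a(x) − Π_l(g, h_1, …, h_m)(x)| ≤ C M^{−1} r^{−n} (χ_{B(x_0,r)}(x) + χ_{B(y_l,r)}(x)). -/
open MeasureTheory Metric

lemma rieszKernelComp_cons (m n : ℕ) (j : Fin m) (i : Fin n)
    (w : EuclideanSpace ℝ (Fin n)) (p : Fin m → EuclideanSpace ℝ (Fin n)) :
    rieszKernelComp m n j i (Fin.cons w p) =
      (w i - p j i) / (Real.sqrt (∑ s, ‖w - p s‖ ^ 2)) ^ (m * n + 1) := by
  simp [rieszKernelComp]

lemma measurable_rieszKernelComp (m n : ℕ) (j : Fin m) (i : Fin n) :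
    Measurable (rieszKernelComp m n j i) := by
  unfold rieszKernelComp
  fun_prop

lemma norm_le_sqrt_sum {ι E : Type*} [Fintype ι] [SeminormedAddCommGroup E] (v : ι → E) (s : ι) :
    ‖v s‖ ≤ Real.sqrt (∑ s, ‖v s‖ ^ 2) :=
  Real.le_sqrt_of_sq_le
    (Finset.single_le_sum (f := fun s => ‖v s‖ ^ 2) (fun _ _ => sq_nonneg _) (Finset.mem_univ s))

lemma sqrt_sum_le_card_mul {ι E : Type*} [Fintype ι] [SeminormedAddCommGroup E] (v : ι → E)
    {R : ℝ} (hR : 0 ≤ R) (h : ∀ s, ‖v s‖ ≤ R) :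
    Real.sqrt (∑ s, ‖v s‖ ^ 2) ≤ Fintype.card ι * R := by
  rw [Real.sqrt_le_iff]
  refine ⟨by positivity, ?_⟩
  have h1 : ∑ s, ‖v s‖ ^ 2 ≤ Fintype.card ι * R ^ 2 := by
    refine (Finset.sum_le_card_nsmul _ _ (R ^ 2) fun s _ => ?_).trans (by simp)
    exact pow_le_pow_left₀ (norm_nonneg _) (h s) 2
  have h2 : (Fintype.card ι : ℝ) ≤ (Fintype.card ι : ℝ) ^ 2 := by
    exact_mod_cast Nat.le_self_pow two_ne_zero _
  nlinarith [sq_nonneg R]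

/-- Changing one entry of a family changes its `ℓ²` norm by at most the norm of the change. -/
lemma abs_sqrt_sum_sub_le {ι E : Type*} [Fintype ι] [SeminormedAddCommGroup E]
    (v v' : ι → E) (l : ι) (h : ∀ s, s ≠ l → v s = v' s) :
    |Real.sqrt (∑ s, ‖v s‖ ^ 2) - Real.sqrt (∑ s, ‖v' s‖ ^ 2)| ≤ ‖v l - v' l‖ := by
  classical
  have hD := norm_le_sqrt_sum v l
  have hD' := norm_le_sqrt_sum v' l
  have hd : (Real.sqrt (∑ s, ‖v s‖ ^ 2)) ^ 2 - (Real.sqrt (∑ s, ‖v' s‖ ^ 2)) ^ 2 =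
      ‖v l‖ ^ 2 - ‖v' l‖ ^ 2 := by
    rw [Real.sq_sqrt (by positivity), Real.sq_sqrt (by positivity), ← Finset.sum_sub_distrib,
      Finset.sum_eq_single l]
    · intro s _ hs
      rw [h s hs, sub_self]
    · simp
  have hab := abs_le.1 (abs_norm_sub_norm_le (v l) (v' l))
  set D := Real.sqrt (∑ s, ‖v s‖ ^ 2)
  set D' := Real.sqrt (∑ s, ‖v' s‖ ^ 2)
  have ha := norm_nonneg (v l)
  have hb := norm_nonneg (v' l)
  set t := ‖v l - v' l‖
  have ht : 0 ≤ t := norm_nonneg _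
  rcases (add_nonneg (ha.trans hD) (hb.trans hD')).eq_or_lt with h0 | h0
  · rw [show D = 0 by linarith, show D' = 0 by linarith]
    simpa using ht
  · rw [abs_le]
    constructor
    · by_contra! hc
      nlinarith [mul_lt_mul_of_pos_right hc h0]
    · by_contra! hc
      nlinarith [mul_lt_mul_of_pos_right hc h0]

lemma abs_div_pow_sub_div_pow_le {N N' D D' δ t R : ℝ} (k : ℕ) (hδ : 0 < δ) (hD : δ ≤ D)
    (hD' : δ ≤ D') (hN : |N - N'| ≤ t) (hDD : |D - D'| ≤ t) (hN' : |N'| ≤ R) :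
    |N / D ^ (k + 1) - N' / D' ^ (k + 1)| ≤
      t / δ ^ (k + 1) * (1 + (k + 1 : ℕ) * (R / δ)) := by
  have h0 : 0 < D := hδ.trans_le hD
  have h0' : 0 < D' := hδ.trans_le hD'
  have ht : 0 ≤ t := (abs_nonneg _).trans hN
  have hR : 0 ≤ R := (abs_nonneg _).trans hN'
  have hi : D⁻¹ ≤ δ⁻¹ := inv_anti₀ hδ hD
  have hi' : D'⁻¹ ≤ δ⁻¹ := inv_anti₀ hδ hD'
  have hinv : |D⁻¹ - D'⁻¹| ≤ t * (δ⁻¹ * δ⁻¹) := by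
    have : D⁻¹ - D'⁻¹ = (D' - D) * (D⁻¹ * D'⁻¹) := by field_simp
    rw [this, abs_mul, abs_sub_comm, abs_of_pos (by positivity : 0 < D⁻¹ * D'⁻¹)]
    gcongr
  have hpow : |D⁻¹ ^ (k + 1) - D'⁻¹ ^ (k + 1)| ≤
      t * (δ⁻¹ * δ⁻¹) * (k + 1 : ℕ) * δ⁻¹ ^ k := by
    refine (abs_pow_sub_pow_le _ _ _).trans ?_
    rw [Nat.add_sub_cancel, abs_of_pos (by positivity : 0 < D⁻¹),
      abs_of_pos (by positivity : 0 < D'⁻¹)]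
    gcongr
    exact max_le hi hi'
  have hsplit : N / D ^ (k + 1) - N' / D' ^ (k + 1) =
      (N - N') * D⁻¹ ^ (k + 1) + N' * (D⁻¹ ^ (k + 1) - D'⁻¹ ^ (k + 1)) := by
    simp only [div_eq_mul_inv, inv_pow]
    ring
  rw [hsplit]
  calc |(N - N') * D⁻¹ ^ (k + 1) + N' * (D⁻¹ ^ (k + 1) - D'⁻¹ ^ (k + 1))|
      ≤ t * δ⁻¹ ^ (k + 1) + R * (t * (δ⁻¹ * δ⁻¹) * (k + 1 : ℕ) * δ⁻¹ ^ k) := by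
        refine (abs_add_le _ _).trans ?_
        rw [abs_mul, abs_mul, abs_of_pos (by positivity : 0 < D⁻¹ ^ (k + 1))]
        gcongr
    _ = t / δ ^ (k + 1) * (1 + (k + 1 : ℕ) * (R / δ)) := by
        simp only [div_eq_mul_inv, ← inv_pow]
        ring

/-- The configuration `(w; p)` is, up to an error `2r`, the collinear configuration in which
`w - p s = κ s • L e`, with the offsets `κ s` of size between `1` and `m`. -/
structure NearDiagonal (m n : ℕ) (κ : Fin m → ℝ) (L r : ℝ)
    (w : EuclideanSpace ℝ (Fin n)) (p : Fin m → EuclideanSpace ℝ (Fin n)) : Prop where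
  one_le : ∀ s, 1 ≤ |κ s|
  le_card : ∀ s, |κ s| ≤ m
  scale : 4 * Real.sqrt n * r ≤ L
  radius_pos : 0 < r
  near : ∀ s, ‖(w - p s) - (κ s * L) • unitDiag n‖ ≤ 2 * r

namespace NearDiagonal

variable {m n : ℕ} {κ : Fin m → ℝ} {L r : ℝ}
  {w : EuclideanSpace ℝ (Fin n)} {p : Fin m → EuclideanSpace ℝ (Fin n)}

lemma four_mul_le (H : NearDiagonal m n κ L r w p) (hn : 1 ≤ n) : 4 * r ≤ L := by
  have h1 : (1 : ℝ) ≤ Real.sqrt n := Real.one_le_sqrt.2 (by exact_mod_cast hn)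
  nlinarith [H.scale, H.radius_pos]

lemma pos (H : NearDiagonal m n κ L r w p) (hn : 1 ≤ n) : 0 < L := by
  linarith [H.four_mul_le hn, H.radius_pos]

lemma norm_smul_unitDiag (H : NearDiagonal m n κ L r w p) (hn : 1 ≤ n) (s : Fin m) :
    ‖(κ s * L) • unitDiag n‖ = |κ s| * L := by
  rw [norm_smul, norm_unitDiag hn, mul_one, Real.norm_eq_abs, abs_mul, abs_of_pos (H.pos hn)]

lemma half_le_norm (H : NearDiagonal m n κ L r w p) (hn : 1 ≤ n) (s : Fin m) :
    L / 2 ≤ ‖w - p s‖ := by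
  have h1 := norm_sub_norm_le ((κ s * L) • unitDiag n) (w - p s)
  rw [norm_sub_rev _ (w - p s), H.norm_smul_unitDiag hn] at h1
  nlinarith [H.near s, H.one_le s, H.pos hn, H.four_mul_le hn]

lemma norm_le (H : NearDiagonal m n κ L r w p) (hn : 1 ≤ n) (s : Fin m) :
    ‖w - p s‖ ≤ 2 * m * L := by
  have h1 := norm_sub_norm_le (w - p s) ((κ s * L) • unitDiag n)
  rw [H.norm_smul_unitDiag hn] at h1
  nlinarith [H.near s, H.one_le s, H.le_card s, H.pos hn, H.four_mul_le hn]

lemma half_le_sqrt (H : NearDiagonal m n κ L r w p) (hn : 1 ≤ n) (s : Fin m) :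
    L / 2 ≤ Real.sqrt (∑ s, ‖w - p s‖ ^ 2) :=
  (H.half_le_norm hn s).trans (norm_le_sqrt_sum (fun s => w - p s) s)

lemma sqrt_le (H : NearDiagonal m n κ L r w p) (hn : 1 ≤ n) :
    Real.sqrt (∑ s, ‖w - p s‖ ^ 2) ≤ 2 * m ^ 2 * L := by
  have := H.pos hn
  refine (sqrt_sum_le_card_mul (fun s => w - p s) (by positivity) (H.norm_le hn)).trans ?_
  rw [Fintype.card_fin]
  exact le_of_eq (by ring)

lemma le_mul_coord (H : NearDiagonal m n κ L r w p) (hn : 1 ≤ n) {σ : ℝ} (hσ : |σ| = 1)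
    (j : Fin m) (hj : 1 ≤ σ * κ j) (i : Fin n) :
    L / (2 * Real.sqrt n) ≤ σ * (w i - p j i) := by
  have hL := H.pos hn
  have hs : 0 < Real.sqrt n := Real.sqrt_pos.2 (by exact_mod_cast hn)
  have h1 := (PiLp.norm_apply_le ((w - p j) - (κ j * L) • unitDiag n) i).trans (H.near j)
  have h2 : ((w - p j) - (κ j * L) • unitDiag n) i =
      (w i - p j i) - κ j * L * (Real.sqrt n)⁻¹ := by
    simp [unitDiag]
  rw [h2, Real.norm_eq_abs] at h1
  have h3 : |σ * ((w i - p j i) - κ j * L * (Real.sqrt n)⁻¹)| ≤ 2 * r := by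
    rwa [abs_mul, hσ, one_mul]
  have h4 := (abs_le.1 h3).1
  have h5 : 1 * (L * (Real.sqrt n)⁻¹) ≤ (σ * κ j) * (L * (Real.sqrt n)⁻¹) := by gcongr
  have h6 : 2 * r ≤ L / (2 * Real.sqrt n) := by
    rw [le_div_iff₀ (by positivity)]
    linarith [H.scale]
  have h7 : L / (2 * Real.sqrt n) = L * (Real.sqrt n)⁻¹ / 2 := by field_simp
  linarith

lemma le_mul_kernel (H : NearDiagonal m n κ L r w p) (hn : 1 ≤ n) {σ : ℝ} (hσ : |σ| = 1)
    (j : Fin m) (hj : 1 ≤ σ * κ j) (i : Fin n) :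
    (2 * Real.sqrt n * (2 * m ^ 2) ^ (m * n + 1))⁻¹ / L ^ (m * n) ≤
      σ * rieszKernelComp m n j i (Fin.cons w p) := by
  have hL := H.pos hn
  have hs : 0 < Real.sqrt n := Real.sqrt_pos.2 (by exact_mod_cast hn)
  have hm : (0 : ℝ) < m := by exact_mod_cast (Fin.pos j)
  have hD : 0 < Real.sqrt (∑ s, ‖w - p s‖ ^ 2) :=
    lt_of_lt_of_le (by positivity) (H.half_le_sqrt hn j)
  rw [rieszKernelComp_cons, ← mul_div_assoc]
  calc (2 * Real.sqrt n * (2 * m ^ 2) ^ (m * n + 1))⁻¹ / L ^ (m * n)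
      = (L / (2 * Real.sqrt n)) / (2 * m ^ 2 * L) ^ (m * n + 1) := by
        rw [mul_pow _ L, pow_succ L]
        field_simp
    _ ≤ _ := by
        gcongr
        · exact (by positivity : 0 ≤ L / (2 * Real.sqrt n)).trans (H.le_mul_coord hn hσ j hj i)
        · exact H.le_mul_coord hn hσ j hj i
        · exact H.sqrt_le hn

lemma abs_coord_le (H : NearDiagonal m n κ L r w p) (hn : 1 ≤ n) (j : Fin m) (i : Fin n) :
    |w i - p j i| ≤ 2 * m * L :=
  (PiLp.norm_apply_le (w - p j) i).trans (H.norm_le hn j)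

lemma abs_kernel_le (H : NearDiagonal m n κ L r w p) (hn : 1 ≤ n) (j : Fin m) (i : Fin n) :
    |rieszKernelComp m n j i (Fin.cons w p)| ≤ 2 * m * L / (L / 2) ^ (m * n + 1) := by
  have hL := H.pos hn
  have hD := H.half_le_sqrt hn j
  rw [rieszKernelComp_cons, abs_div, abs_of_nonneg (by positivity :
    0 ≤ Real.sqrt (∑ s, ‖w - p s‖ ^ 2) ^ (m * n + 1))]
  gcongr
  exact H.abs_coord_le hn j i

lemma abs_kernel_sub_le (H : NearDiagonal m n κ L r w p) (hn : 1 ≤ n) (j l : Fin m) (i : Fin n)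
    {p' : Fin m → EuclideanSpace ℝ (Fin n)} (H' : NearDiagonal m n κ L r w p')
    (heq : ∀ s, s ≠ l → p s = p' s) (hl : ‖p l - p' l‖ ≤ r) :
    |rieszKernelComp m n j i (Fin.cons w p) - rieszKernelComp m n j i (Fin.cons w p')| ≤
      2 ^ (m * n + 1) * (1 + (m * n + 1) * (4 * m)) * r / L ^ (m * n + 1) := by
  have hL := H.pos hn
  have hN : |(w i - p j i) - (w i - p' j i)| ≤ r := by
    rw [sub_sub_sub_cancel_left]
    by_cases hj : j = l
    · subst hj
      refine le_trans ?_ hl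
      rw [norm_sub_rev]
      exact PiLp.norm_apply_le (p' j - p j) i
    · simp [heq j hj, H.radius_pos.le]
  have hDD : |Real.sqrt (∑ s, ‖w - p s‖ ^ 2) - Real.sqrt (∑ s, ‖w - p' s‖ ^ 2)| ≤ r := by
    refine (abs_sqrt_sum_sub_le (fun s => w - p s) (fun s => w - p' s) l ?_).trans ?_
    · intro s hs
      simp [heq s hs]
    · rwa [sub_sub_sub_cancel_left, norm_sub_rev]
  rw [rieszKernelComp_cons, rieszKernelComp_cons]
  refine (abs_div_pow_sub_div_pow_le (m * n) (by positivity : 0 < L / 2) (H.half_le_sqrt hn j)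
    (H'.half_le_sqrt hn j) hN hDD (H'.abs_coord_le hn j i)).trans (le_of_eq ?_)
  push_cast
  rw [div_pow]
  field_simp
  ring

end NearDiagonal

lemma integral_update_mul_eq_zero {m : ℕ} {E : Type*} [MeasureSpace E]
    [SigmaFinite (volume : Measure E)] (l : Fin m) (u : E) (G : (Fin m → E) → ℝ) (b : E → ℝ)
    (hb : ∫ x, b x = 0) :
    ∫ z : Fin m → E, G (Function.update z l u) * b (z l) = 0 := by
  obtain _ | m := m
  · exact l.elim0
  · have h := (volume_preserving_piFinSuccAbove (fun _ : Fin (m + 1) => E) l).integral_comp'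
      (fun q => b q.1 * G (l.insertNth u q.2))
    rw [Measure.volume_eq_prod, integral_prod_mul b (fun v => G (l.insertNth u v)), hb,
      zero_mul] at h
    rw [← h]
    refine integral_congr_ae (Filter.Eventually.of_forall fun z => ?_)
    simp only [MeasurableEquiv.piFinSuccAbove, MeasurableEquiv.coe_mk, Fin.insertNthEquiv]
    simp [mul_comm, Fin.insertNth_removeNth]

/-- The signed offset, in units of `M r e`, between `y_l` and the `s`-th point of the configuration
in which `y_l` has been replaced by `x₀`. -/
def diagOffset {m : ℕ} (l s : Fin m) : ℝ :=
  if s = l then ((l : ℕ) : ℝ) + 1 else ((l : ℕ) : ℝ) - ((s : ℕ) : ℝ)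

lemma one_le_abs_diagOffset {m : ℕ} (l s : Fin m) : 1 ≤ |diagOffset l s| := by
  unfold diagOffset
  split_ifs with h
  · rw [abs_of_pos (by positivity)]
    simp
  · have h1 : ((l : ℕ) : ℤ) - ((s : ℕ) : ℤ) ≠ 0 := by
      rw [sub_ne_zero]
      exact fun h2 => h (Fin.ext (by exact_mod_cast h2.symm))
    exact_mod_cast Int.one_le_abs h1

lemma abs_diagOffset_le {m : ℕ} (l s : Fin m) : |diagOffset l s| ≤ m := by
  have hl : ((l : ℕ) : ℝ) + 1 ≤ m := by exact_mod_cast l.2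
  have hs : ((s : ℕ) : ℝ) + 1 ≤ m := by exact_mod_cast s.2
  have hl0 : (0 : ℝ) ≤ ((l : ℕ) : ℝ) := Nat.cast_nonneg _
  have hs0 : (0 : ℝ) ≤ ((s : ℕ) : ℝ) := Nat.cast_nonneg _
  unfold diagOffset
  split_ifs <;> rw [abs_le] <;> constructor <;> linarith

lemma nearDiagonal_diagOffset {m n : ℕ} (hm : 1 ≤ m) (hn : 1 ≤ n) {l : Fin m}
    {x₀ w : EuclideanSpace ℝ (Fin n)} {r M : ℝ} (hr : 0 < r) (hM : (100 * m * n : ℝ) ≤ M)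
    {p : Fin m → EuclideanSpace ℝ (Fin n)}
    (hw : w ∈ Metric.ball (x₀ + ((((l : ℕ) : ℝ) + 1) * (M * r)) • unitDiag n) r)
    (hp : ∀ s, s ≠ l →
      p s ∈ Metric.ball (x₀ + ((((s : ℕ) : ℝ) + 1) * (M * r)) • unitDiag n) r)
    (hpl : p l ∈ Metric.ball x₀ r) :
    NearDiagonal m n (diagOffset l) (M * r) r w p where
  one_le := one_le_abs_diagOffset l
  le_card := abs_diagOffset_le l
  scale := by
    have h1 : Real.sqrt n ≤ n := by
      rw [Real.sqrt_le_iff]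
      exact ⟨by positivity, by exact_mod_cast Nat.le_self_pow two_ne_zero _⟩
    have h2 : (1 : ℝ) ≤ m := by exact_mod_cast hm
    have h3 : (0 : ℝ) ≤ n := by positivity
    have h4 : (n : ℝ) ≤ m * n := by nlinarith
    gcongr
    linarith
  radius_pos := hr
  near s := by
    rw [mem_ball_iff_norm] at hw
    by_cases h : s = l
    · subst h
      rw [mem_ball_iff_norm] at hpl
      have h1 : (w - p s) - (diagOffset s s * (M * r)) • unitDiag n =
          (w - (x₀ + ((((s : ℕ) : ℝ) + 1) * (M * r)) • unitDiag n)) - (p s - x₀) := by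
        simp only [diagOffset, if_true]
        module
      rw [h1]
      exact (norm_sub_le _ _).trans (by linarith)
    · have h2 := hp s h
      rw [mem_ball_iff_norm] at h2
      have h1 : (w - p s) - (diagOffset l s * (M * r)) • unitDiag n =
          (w - (x₀ + ((((l : ℕ) : ℝ) + 1) * (M * r)) • unitDiag n)) -
            (p s - (x₀ + ((((s : ℕ) : ℝ) + 1) * (M * r)) • unitDiag n)) := by
        simp only [diagOffset, if_neg h]
        module
      rw [h1]
      exact (norm_sub_le _ _).trans (by linarith)

lemma TmulAdj_indicator (m n : ℕ) (j l : Fin m) (i : Fin n)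
    (B : Fin m → Set (EuclideanSpace ℝ (Fin n))) (hB : ∀ s, MeasurableSet (B s))
    (f x) :
    TmulAdj m n j l i ((B l).indicator fun _ => 1)
      (Function.update (fun s => (B s).indicator fun _ => 1) l f) x =
    ∫ z in Set.univ.pi B, rieszKernelComp m n j i (Fin.cons (z l) (Function.update z l x)) := by
  rw [← integral_indicator (MeasurableSet.univ_pi hB), TmulAdj]
  refine integral_congr_ae (Filter.Eventually.of_forall fun z => ?_)
  have h1 : ∏ s ∈ Finset.univ.erase l,
      Function.update (fun s => (B s).indicator fun _ => (1 : ℝ)) l f s (z s) =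
      ∏ s ∈ Finset.univ.erase l, (B s).indicator (fun _ => (1 : ℝ)) (z s) :=
    Finset.prod_congr rfl fun s hs => by rw [Function.update_of_ne (Finset.ne_of_mem_erase hs)]
  simp only [h1, ← Fin.cons_update]
  rw [Finset.mul_prod_erase Finset.univ (fun s => (B s).indicator (fun _ => (1 : ℝ)) (z s))
    (Finset.mem_univ l)]
  by_cases hz : z ∈ Set.univ.pi B
  · rw [Set.indicator_of_mem hz, Finset.prod_eq_one, mul_one]
    exact fun s _ => Set.indicator_of_mem (hz s (Set.mem_univ s)) _
  · rw [Set.indicator_of_notMem hz]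
    rw [Set.mem_univ_pi, not_forall] at hz
    obtain ⟨s, hs⟩ := hz
    rw [Finset.prod_eq_zero (Finset.mem_univ s) (Set.indicator_of_notMem hs _), mul_zero]

lemma measurable_cons_update {m : ℕ} {E : Type*} [MeasurableSpace E] (l : Fin m) (x : E) :
    Measurable fun z : Fin m → E => (Fin.cons (z l) (Function.update z l x) : Fin (m + 1) → E) := by
  rw [measurable_pi_iff]
  intro k
  refine Fin.cases ?_ (fun s => ?_) k
  · simpa using measurable_pi_apply l
  · simp only [Fin.cons_succ]
    by_cases hs : s = l
    · subst hs
      simp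
    · simpa [Function.update_of_ne hs] using measurable_pi_apply s

lemma measurable_cons {m : ℕ} {E : Type*} [MeasurableSpace E] (x : E) :
    Measurable fun z : Fin m → E => (Fin.cons x z : Fin (m + 1) → E) := by
  rw [measurable_pi_iff]
  intro k
  refine Fin.cases ?_ (fun s => ?_) k
  · simp
  · simpa using measurable_pi_apply s

/-- A function bounded by `ε` on the support of an integrable `H` has integral at most `ε ∫ |H|`
against `H`. -/
lemma abs_integral_mul_le {α : Type*} [MeasurableSpace α] {μ : Measure α} {F H : α → ℝ} {ε : ℝ}
    (hH : Integrable H μ) (hF : ∀ z, H z ≠ 0 → |F z| ≤ ε) :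
    |∫ z, F z * H z ∂μ| ≤ ε * ∫ z, |H z| ∂μ := by
  rw [← integral_const_mul, ← Real.norm_eq_abs]
  refine norm_integral_le_of_norm_le (hH.abs.const_mul ε) (Filter.Eventually.of_forall fun z => ?_)
  by_cases hz : H z = 0
  · simp [hz]
  · rw [norm_mul, Real.norm_eq_abs, Real.norm_eq_abs]
    exact mul_le_mul_of_nonneg_right (hF z hz) (abs_nonneg _)

lemma integrable_mul_of_bound_on_support {α : Type*} [MeasurableSpace α] {μ : Measure α}
    {F H : α → ℝ} {R : ℝ} (hH : Integrable H μ) (hFm : Measurable F)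
    (hF : ∀ z, H z ≠ 0 → |F z| ≤ R) :
    Integrable (fun z => F z * H z) μ := by
  refine (hH.norm.const_mul R).mono' (hFm.aestronglyMeasurable.mul hH.1)
    (Filter.Eventually.of_forall fun z => ?_)
  by_cases hz : H z = 0
  · simp [hz]
  · rw [norm_mul]
    exact mul_le_mul_of_nonneg_right (hF z hz) (norm_nonneg _)

lemma measureReal_univ_pi_ball {m n : ℕ} (y : Fin m → EuclideanSpace ℝ (Fin n)) (r : ℝ) :
    volume.real (Set.univ.pi fun s => Metric.ball (y s) r) =
      volume.real (Metric.ball (0 : EuclideanSpace ℝ (Fin n)) r) ^ m := by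
  simp [Measure.real, volume_pi_pi, Measure.addHaar_ball_center]

/-- Lower bound for an integral whose integrand keeps a constant sign `σ` and is bounded away from
zero. -/
lemma mul_measureReal_le_abs_setIntegral {α : Type*} [MeasurableSpace α] {μ : Measure α}
    {F : α → ℝ} {s : Set α} {σ δ : ℝ} (hs : MeasurableSet s) (hμ : μ s ≠ ⊤)
    (hF : IntegrableOn F s μ) (hσ : |σ| = 1) (h : ∀ z ∈ s, δ ≤ σ * F z) :
    δ * μ.real s ≤ |∫ z in s, F z ∂μ| := by
  calc δ * μ.real s = ∫ _ in s, δ ∂μ := by simp [mul_comm]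
    _ ≤ ∫ z in s, σ * F z ∂μ :=
        setIntegral_mono_on (integrableOn_const hμ) (hF.const_mul σ) hs h
    _ = σ * ∫ z in s, F z ∂μ := integral_const_mul _ _
    _ ≤ |∫ z in s, F z ∂μ| := by
        refine (le_abs_self _).trans ?_
        rw [abs_mul, hσ, one_mul]

lemma atom_integrable {n : ℕ} {a : EuclideanSpace ℝ (Fin n) → ℝ}
    {x₀ : EuclideanSpace ℝ (Fin n)} {r : ℝ} (ha : Measurable a)
    (hsupp : ∀ z, z ∉ Metric.ball x₀ r → a z = 0) (hb : ∀ᵐ z, |a z| ≤ (r ^ n)⁻¹) :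
    Integrable a ∧ ∫ z, |a z| ≤
      (r ^ n)⁻¹ * volume.real (Metric.ball (0 : EuclideanSpace ℝ (Fin n)) r) := by
  have hI : Integrable ((Metric.ball x₀ r).indicator fun _ => (r ^ n)⁻¹) :=
    (integrable_indicator_iff measurableSet_ball).2 (integrableOn_const measure_ball_lt_top.ne)
  have hle : ∀ᵐ z, ‖a z‖ ≤ (Metric.ball x₀ r).indicator (fun _ => (r ^ n)⁻¹) z := by
    filter_upwards [hb] with z hz
    by_cases hzb : z ∈ Metric.ball x₀ r
    · rwa [Set.indicator_of_mem hzb]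
    · rw [Set.indicator_of_notMem hzb, hsupp z hzb, norm_zero]
  have hint : Integrable a := hI.mono' ha.aestronglyMeasurable hle
  refine ⟨hint, (integral_mono_ae hint.abs hI hle).trans (le_of_eq ?_)⟩
  rw [integral_indicator measurableSet_ball, setIntegral_const, smul_eq_mul, mul_comm, Measure.real,
    Measure.addHaar_ball_center, Measure.real]

lemma integral_abs_prod_update_indicator {m : ℕ} {E : Type*} [MeasureSpace E]
    [SigmaFinite (volume : Measure E)] (l : Fin m) (B : Fin m → Set E)
    (hB : ∀ s, MeasurableSet (B s)) {ρ : ℝ} (hρ : ∀ s, volume.real (B s) = ρ) (f : E → ℝ) :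
    ∫ z : Fin m → E, |∏ s, Function.update (fun s => (B s).indicator fun _ => (1 : ℝ)) l f s (z s)| =
      (∫ x, |f x|) * ρ ^ (m - 1) := by
  simp only [Finset.abs_prod]
  rw [integral_fintype_prod_volume_eq_prod
    (fun s x => |Function.update (fun s => (B s).indicator fun _ => (1 : ℝ)) l f s x|),
    ← Finset.mul_prod_erase Finset.univ _ (Finset.mem_univ l), Function.update_self]
  congr 1
  rw [Finset.prod_congr rfl (g := fun _ => ρ)]
  · simp [Finset.card_erase_of_mem]
  · intro s hs
    rw [Function.update_of_ne (Finset.ne_of_mem_erase hs)]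
    have h1 : ∀ x, |(B s).indicator (fun _ => (1 : ℝ)) x| = (B s).indicator (fun _ => (1 : ℝ)) x :=
      fun x => abs_of_nonneg (Set.indicator_nonneg (fun _ _ => zero_le_one) x)
    simp only [h1]
    rw [integral_indicator (hB s), setIntegral_const, hρ s, smul_eq_mul, mul_one]

lemma integral_mul_prod_update_eq_zero {m : ℕ} {E : Type*} [MeasureSpace E]
    [SigmaFinite (volume : Measure E)] (l : Fin m) (u : E) (G : (Fin m → E) → ℝ)
    (k : Fin m → E → ℝ) (f : E → ℝ) (hf : ∫ x, f x = 0) :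
    ∫ z : Fin m → E, G (Function.update z l u) * ∏ s, Function.update k l f s (z s) = 0 := by
  rw [← integral_update_mul_eq_zero l u
    (fun z => G z * ∏ s ∈ Finset.univ.erase l, k s (z s)) f hf]
  refine integral_congr_ae (Filter.Eventually.of_forall fun z => ?_)
  simp only
  rw [← Finset.mul_prod_erase Finset.univ _ (Finset.mem_univ l), Function.update_self,
    Finset.prod_congr rfl (g := fun s => k s (Function.update z l u s))]
  · ring
  · intro s hs
    rw [Function.update_of_ne (Finset.ne_of_mem_erase hs),
      Function.update_of_ne (Finset.ne_of_mem_erase hs)]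

/-- pointwise approximate factorization of an atom.  With
`y_s = x₀ + sMr·e` for `s = 1, …, m`, `g = χ_{B(y_l,r)}`, `h_s = χ_{B(y_s,r)}` for
`s ≠ l`, and `h_l = a/c₀` where
`c₀ = ∫_{B(y₁,r)×⋯×B(y_m,r)} K_j^{(i)}(z_l, z₁, …, x₀, …, z_m) dz` (which is nonzero),
one has `|a − Π_l(g, h₁, …, h_m)| ≤ C M^{−1} r^{−n}(χ_{B(x₀,r)} + χ_{B(y_l,r)})` a.e. -/
theorem atom_approximate_factorization_pointwise (m n : ℕ) (hm : 1 ≤ m) (hn : 1 ≤ n) :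
    ∃ C : ℝ, 0 < C ∧ ∀ (i : Fin n) (j l : Fin m)
      (x₀ : EuclideanSpace ℝ (Fin n)) (r M : ℝ), 0 < r → (100 * m * n : ℝ) ≤ M →
      ∀ a : EuclideanSpace ℝ (Fin n) → ℝ, Measurable a →
      (∀ z, z ∉ Metric.ball x₀ r → a z = 0) →
      (∀ᵐ z, |a z| ≤ (r ^ n)⁻¹) → (∫ z, a z) = 0 →
      let y : Fin m → EuclideanSpace ℝ (Fin n) :=
        fun s => x₀ + ((((s : ℕ) : ℝ) + 1) * (M * r)) • unitDiag n
      let c₀ : ℝ := ∫ z in Set.univ.pi (fun s : Fin m => Metric.ball (y s) r),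
        rieszKernelComp m n j i (Function.update (Fin.cons (z l) z) l.succ x₀)
      let g : EuclideanSpace ℝ (Fin n) → ℝ :=
        (Metric.ball (y l) r).indicator (fun _ => (1 : ℝ))
      let h : Fin m → EuclideanSpace ℝ (Fin n) → ℝ :=
        Function.update
          (fun s => (Metric.ball (y s) r).indicator (fun _ => (1 : ℝ)))
          l (fun x => a x / c₀)
      c₀ ≠ 0 ∧
      ∀ᵐ x, |a x - PiOp m n j l i g h x| ≤
        C / M / r ^ n *
          ((Metric.ball x₀ r).indicator (fun _ => (1 : ℝ)) x +
            (Metric.ball (y l) r).indicator (fun _ => (1 : ℝ)) x) := by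
  set c₁ : ℝ := (2 * Real.sqrt n * (2 * m ^ 2) ^ (m * n + 1))⁻¹ with hc₁
  set A : ℝ := 2 ^ (m * n + 1) * (1 + (m * n + 1) * (4 * m)) with hA
  have hm0 : (0 : ℝ) < m := by exact_mod_cast hm
  have hn0 : (0 : ℝ) < n := by exact_mod_cast hn
  have hc₁0 : 0 < c₁ := by
    have : 0 < Real.sqrt n := Real.sqrt_pos.2 hn0
    positivity
  have hA0 : 0 < A := by positivity
  refine ⟨A / c₁, by positivity, ?_⟩
  intro i j l x₀ r M hr hM a ha hsupp hb hmean y c₀ g h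
  have hM0 : 0 < M := lt_of_lt_of_le (by positivity) hM
  set L := M * r with hL
  have hL0 : 0 < L := by positivity
  set ρ := volume.real (Metric.ball (0 : EuclideanSpace ℝ (Fin n)) r) with hρ
  have hρ0 : 0 < ρ := ENNReal.toReal_pos (measure_ball_pos _ _ hr).ne' measure_ball_lt_top.ne
  set δ := c₁ / L ^ (m * n) with hδ
  set ε := A * r / L ^ (m * n + 1) with hε
  have hδ0 : 0 < δ := by positivity
  have hε0 : 0 < ε := by positivity
  have hεδ : ε / δ = A / c₁ / M := by
    rw [hε, hδ, pow_succ, hL]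
    field_simp
  set P := Set.univ.pi fun s => Metric.ball (y s) r with hP
  have hPm : MeasurableSet P := MeasurableSet.univ_pi fun _ => measurableSet_ball
  have hPv : volume.real P = ρ ^ m := measureReal_univ_pi_ball y r
  have hPt : volume P ≠ ⊤ := by
    refine fun h => (pow_pos hρ0 m).ne ?_
    rw [← hPv, Measure.real, h, ENNReal.toReal_top]
  have hnear : ∀ w p, w ∈ Metric.ball (y l) r → (∀ s, s ≠ l → p s ∈ Metric.ball (y s) r) →
      p l ∈ Metric.ball x₀ r → NearDiagonal m n (diagOffset l) L r w p :=
    fun w p hw hp hpl => nearDiagonal_diagOffset hm hn hr hM hw hp hpl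
  have hnearu : ∀ w (z : Fin m → EuclideanSpace ℝ (Fin n)) u, w ∈ Metric.ball (y l) r →
      (∀ s, s ≠ l → z s ∈ Metric.ball (y s) r) → u ∈ Metric.ball x₀ r →
      NearDiagonal m n (diagOffset l) L r w (Function.update z l u) := by
    intro w z u hw hz hu
    refine hnear w _ hw (fun s hs => ?_) (by rwa [Function.update_self])
    rw [Function.update_of_ne hs]
    exact hz s hs
  have hx₀ : x₀ ∈ Metric.ball x₀ r := Metric.mem_ball_self hr
  -- the kernels whose averages over `P` are the values of the adjoint
  let F : EuclideanSpace ℝ (Fin n) → (Fin m → EuclideanSpace ℝ (Fin n)) → ℝ :=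
    fun x z => rieszKernelComp m n j i (Fin.cons (z l) (Function.update z l x))
  have hFnear : ∀ x ∈ Metric.ball x₀ r, ∀ z ∈ P,
      NearDiagonal m n (diagOffset l) L r (z l) (Function.update z l x) := fun x hx z hz =>
    hnearu _ z x (hz l (Set.mem_univ l)) (fun s _ => hz s (Set.mem_univ s)) hx
  have hFint : ∀ x ∈ Metric.ball x₀ r, IntegrableOn (F x) P := fun x hx =>
    Measure.integrableOn_of_bounded hPt
      ((measurable_rieszKernelComp m n j i).comp (measurable_cons_update l x)).aestronglyMeasurable
      ((ae_restrict_iff' hPm).2 (Filter.Eventually.of_forall fun z hz =>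
        (hFnear x hx z hz).abs_kernel_le hn j i))
  have hc₀F : c₀ = ∫ z in P, F x₀ z := by
    simp only [c₀, F, Fin.cons_update]
    rfl
  have hc₀ : δ * ρ ^ m ≤ |c₀| := by
    obtain ⟨σ, hσ, hσκ⟩ : ∃ σ : ℝ, |σ| = 1 ∧ 1 ≤ σ * diagOffset l j := by
      rcases le_abs.1 (one_le_abs_diagOffset l j) with h1 | h1
      · exact ⟨1, by simp, by simpa using h1⟩
      · exact ⟨-1, by simp, by simpa using h1⟩
    rw [hc₀F, ← hPv]
    exact mul_measureReal_le_abs_setIntegral hPm hPt (hFint x₀ hx₀) hσ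
      fun z hz => (hFnear x₀ hx₀ z hz).le_mul_kernel hn hσ j hσκ i
  have hc₀pos : 0 < |c₀| := lt_of_lt_of_le (by positivity) hc₀
  refine ⟨abs_pos.1 hc₀pos, ?_⟩
  have hratio : ε * ρ ^ m / |c₀| ≤ A / c₁ / M := by
    rw [← hεδ]
    calc ε * ρ ^ m / |c₀| ≤ ε * ρ ^ m / (δ * ρ ^ m) := by gcongr
      _ = ε / δ := by field_simp
  have hadj : ∀ x ∈ Metric.ball x₀ r, |TmulAdj m n j l i g h x - c₀| ≤ ε * ρ ^ m := by
    intro x hx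
    have h1 : TmulAdj m n j l i g h x = ∫ z in P, F x z :=
      TmulAdj_indicator m n j l i (fun s => Metric.ball (y s) r) (fun _ => measurableSet_ball) _ x
    rw [h1, hc₀F, ← integral_sub (hFint x hx) (hFint x₀ hx₀), ← hPv, ← Real.norm_eq_abs]
    refine norm_setIntegral_le_of_norm_le_const hPt.lt_top fun z hz => ?_
    refine (hFnear x hx z hz).abs_kernel_sub_le hn j l i (hFnear x₀ hx₀ z hz) (fun s hs => ?_) ?_
    · rw [Function.update_of_ne hs, Function.update_of_ne hs]
    · rw [Function.update_self, Function.update_self]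
      exact (mem_ball_iff_norm.1 hx).le
  obtain ⟨haint, haL1⟩ := atom_integrable ha hsupp hb
  have hT : ∀ x ∈ Metric.ball (y l) r, |Tmul m n j i h x| ≤ A / c₁ / M / r ^ n := by
    intro x hx
    let H : (Fin m → EuclideanSpace ℝ (Fin n)) → ℝ := fun z => ∏ s, h s (z s)
    have hHmem : ∀ z, H z ≠ 0 →
        (∀ s, s ≠ l → z s ∈ Metric.ball (y s) r) ∧ z l ∈ Metric.ball x₀ r := by
      intro z hz
      have h1 := fun s => Finset.prod_ne_zero_iff.1 hz s (Finset.mem_univ s)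
      refine ⟨fun s hs => ?_, ?_⟩
      · have h2 := h1 s
        simp only [h, Function.update_of_ne hs] at h2
        exact Set.mem_of_indicator_ne_zero h2
      · have h2 := h1 l
        simp only [h, Function.update_self] at h2
        by_contra h3
        exact h2 (by rw [hsupp _ h3, zero_div])
    have hHint : Integrable H := by
      refine Integrable.fintype_prod (f := h) (μ := fun _ => volume) fun s => ?_
      by_cases hs : s = l
      · subst hs
        simp only [h, Function.update_self]
        exact haint.div_const c₀
      · simp only [h, Function.update_of_ne hs]
        exact (integrable_indicator_iff measurableSet_ball).2
          (integrableOn_const measure_ball_lt_top.ne)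
    have hHL1 : ∫ z, |H z| ≤ (r ^ n)⁻¹ * ρ / |c₀| * ρ ^ (m - 1) := by
      rw [integral_abs_prod_update_indicator l (fun s => Metric.ball (y s) r)
        (fun _ => measurableSet_ball) (ρ := ρ)
        (fun s => by rw [hρ, Measure.real, Measure.addHaar_ball_center, Measure.real])]
      simp only [abs_div, integral_div]
      gcongr
    have hzero : ∫ z, rieszKernelComp m n j i (Fin.cons x (Function.update z l x₀)) * H z = 0 :=
      integral_mul_prod_update_eq_zero l x₀ (fun z => rieszKernelComp m n j i (Fin.cons x z)) _ _
        (by rw [integral_div, hmean, zero_div])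
    have hmeas : Measurable fun z : Fin m → EuclideanSpace ℝ (Fin n) =>
        rieszKernelComp m n j i (Fin.cons x z) :=
      (measurable_rieszKernelComp m n j i).comp (measurable_cons x)
    have hint₁ : Integrable fun z => rieszKernelComp m n j i (Fin.cons x z) * H z :=
      integrable_mul_of_bound_on_support hHint hmeas fun z hz =>
        (hnear x z hx (hHmem z hz).1 (hHmem z hz).2).abs_kernel_le hn j i
    have hint₀ : Integrable fun z =>
        rieszKernelComp m n j i (Fin.cons x (Function.update z l x₀)) * H z :=
      integrable_mul_of_bound_on_support hHint
        (hmeas.comp (measurable_update'.comp (measurable_id.prodMk measurable_const)))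
        fun z hz => (hnearu x z x₀ hx (hHmem z hz).1 hx₀).abs_kernel_le hn j i
    have hTdiff : Tmul m n j i h x = ∫ z, (rieszKernelComp m n j i (Fin.cons x z) -
        rieszKernelComp m n j i (Fin.cons x (Function.update z l x₀))) * H z := by
      simp only [sub_mul]
      rw [integral_sub hint₁ hint₀, hzero, sub_zero]
      rfl
    rw [hTdiff]
    calc _ ≤ ε * ∫ z, |H z| := by
          refine abs_integral_mul_le hHint fun z hz => ?_
          refine (hnear x z hx (hHmem z hz).1 (hHmem z hz).2).abs_kernel_sub_le hn j l i
            (hnearu x z x₀ hx (hHmem z hz).1 hx₀) (fun s hs => ?_) ?_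
          · rw [Function.update_of_ne hs]
          · rw [Function.update_self]
            exact (mem_ball_iff_norm.1 (hHmem z hz).2).le
      _ ≤ ε * ((r ^ n)⁻¹ * ρ / |c₀| * ρ ^ (m - 1)) := by gcongr
      _ = ε * ρ ^ m / |c₀| / r ^ n := by
          rw [← Nat.sub_add_cancel hm, pow_succ, Nat.add_sub_cancel]
          field_simp
      _ ≤ _ := by gcongr
  filter_upwards [hb] with x hax
  have hsplit : a x - PiOp m n j l i g h x =
      a x * ((c₀ - TmulAdj m n j l i g h x) / c₀) + g x * Tmul m n j i h x := by
    have h1 : h l x = a x / c₀ := by simp only [h, Function.update_self]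
    have h2 : c₀ ≠ 0 := abs_pos.1 hc₀pos
    rw [PiOp, h1]
    field_simp
    ring
  rw [hsplit, mul_add]
  refine (abs_add_le _ _).trans (add_le_add ?_ ?_)
  · by_cases hx : x ∈ Metric.ball x₀ r
    · rw [Set.indicator_of_mem hx, abs_mul, abs_div, abs_sub_comm, mul_one]
      calc _ ≤ (r ^ n)⁻¹ * (ε * ρ ^ m / |c₀|) := by
            gcongr
            exact hadj x hx
        _ ≤ (r ^ n)⁻¹ * (A / c₁ / M) := by gcongr
        _ = _ := by rw [inv_mul_eq_div]
    · rw [Set.indicator_of_notMem hx, hsupp x hx]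
      simp
  · by_cases hx : x ∈ Metric.ball (y l) r
    · simp only [g, Set.indicator_of_mem hx, one_mul, mul_one]
      exact hT x hx
    · simp only [g, Set.indicator_of_notMem hx, zero_mul, mul_zero, abs_zero, le_refl]
end
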